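/- arXiv:2410.23486 — 6 statements merged into one kernel-verified Lean document; each statement's English description precedes it below -/
import Mathlib

section
/- Let K be a field, let N ≥ r ≥ 1 be integers, and let z_1,…,z_N ∈ K be pairwise distinct. Let λ = (λ_1 ≥ … ≥ λ_r ≥ 0) be a partition and let m be an integer with m + N − r ≥ 0. Then Σ_{I ⊆ {1,…,N}, |I| = r} s_λ( (z_i)_{i∈I} ) · ∏_{i∈I} ( z_i^{m+N−r} / ∏_{j∉I} (z_i − z_j) ) = s_a(z_1,…,z_N), where a = (λ_1 + m, λ_2 + m, …, λ_r + m, 0, …, 0) ∈ ℤ^N has N − r trailing zeros. (All exponents occurring, namely λ_i + m + N − i and N − i, are nonnegative.) -/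
/-- The Schur polynomial `s_λ(w_1,…,w_r)` of a partition `λ` evaluated at field elements,
via Jacobi's bialternant formula. -/
noncomputable def schurVal {K : Type*} [Field K] (r : ℕ) (lam : Fin r → ℕ)
    (w : Fin r → K) : K :=
  Matrix.det (Matrix.of fun i j : Fin r => w j ^ (lam i + (r - 1 - (i : ℕ)))) /
  Matrix.det (Matrix.of fun i j : Fin r => w j ^ (r - 1 - (i : ℕ)))

/-- The generalized Schur function `s_a(z_1,…,z_N)` for an integer vector `a ∈ ℤ^N`. -/
noncomputable def genSchurVal {K : Type*} [Field K] (N : ℕ) (a : Fin N → ℤ)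
    (z : Fin N → K) : K :=
  Matrix.det (Matrix.of fun i j : Fin N => z j ^ (a i + ((N : ℤ) - 1 - ((i : ℕ) : ℤ)))) /
  Matrix.det (Matrix.of fun i j : Fin N => z j ^ ((N : ℤ) - 1 - ((i : ℕ) : ℤ)))

open Finset in
/-- Laplace expansion along a set `S` of rows: the determinant is the sum, over all sets `I` of
columns with `#S` elements, of the determinants of the matrices obtained by erasing the entries
outside the blocks `S × I` and `Sᶜ × Iᶜ`. -/
theorem Matrix.det_eq_sum_powersetCard_det {n R : Type*} [Fintype n] [DecidableEq n] [CommRing R]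
    (A : Matrix n n R) (S : Finset n) :
    A.det = ∑ I ∈ powersetCard #S univ,
      (Matrix.of fun i j => if i ∈ S ↔ j ∈ I then A i j else 0).det := by
  simp only [Matrix.det_apply', Matrix.of_apply]
  rw [sum_comm]
  refine sum_congr rfl fun σ _ => ?_
  have hmem (i : n) : i ∈ S.map σ.symm.toEmbedding ↔ σ i ∈ S := by simp
  rw [← mul_sum, sum_eq_single (S.map σ.symm.toEmbedding)]
  · simp only [hmem, if_true]
  · intro I _ hI
    obtain ⟨i, hi⟩ : ∃ i, ¬(σ i ∈ S ↔ i ∈ I) := by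
      by_contra! h
      exact hI (Finset.ext fun i => ((hmem i).trans (h i)).symm)
    exact prod_eq_zero (mem_univ i) (if_neg hi)
  · intro h
    exact absurd (mem_powersetCard.2 ⟨subset_univ _, card_map _⟩) h

/-- Reindexing rows and columns by two equivalences changes the determinant by a sign that does
not depend on the matrix. -/
theorem Matrix.det_submatrix_equiv_equiv {m n R : Type*} [Fintype m] [DecidableEq m] [Fintype n]
    [DecidableEq n] [CommRing R] (A : Matrix n n R) (f e : m ≃ n) :
    (A.submatrix f e).det = Equiv.Perm.sign (e.trans f.symm) * A.det := by
  rw [← Matrix.det_submatrix_equiv_self f A, ← Matrix.det_permute', Matrix.submatrix_submatrix]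
  congr 2
  ext i
  simp

/-- The Vandermonde determinant with descending powers. -/
theorem Matrix.det_descVandermonde {R : Type*} [CommRing R] (n : ℕ) (w : Fin n → R) :
    (Matrix.of fun i j : Fin n => w j ^ (n - 1 - (i : ℕ))).det =
      ∏ i, ∏ j, if i < j then w i - w j else 1 := by
  have h : (Matrix.of fun i j : Fin n => w j ^ (n - 1 - (i : ℕ))) =
      (Matrix.projVandermonde 1 w).transpose := by
    ext i j
    simp [Matrix.projVandermonde_apply, Fin.val_rev, Nat.sub_sub, add_comm]
  rw [h, Matrix.det_transpose, Matrix.det_projVandermonde]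
  refine Finset.prod_congr rfl fun i _ => ?_
  rw [← Finset.prod_filter]
  refine Finset.prod_congr (by ext; simp) fun j _ => by simp

theorem Matrix.det_descVandermonde_ne_zero {K : Type*} [Field K] {n : ℕ} {w : Fin n → K}
    (hw : Function.Injective w) :
    (Matrix.of fun i j : Fin n => w j ^ (n - 1 - (i : ℕ))).det ≠ 0 := by
  rw [Matrix.det_descVandermonde]
  refine Finset.prod_ne_zero_iff.2 fun i _ => Finset.prod_ne_zero_iff.2 fun j _ => ?_
  split_ifs with h
  · exact sub_ne_zero.2 (hw.ne h.ne)
  · exact one_ne_zero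

/-- The Vandermonde determinant of a concatenation of two families of variables. -/
theorem Matrix.det_descVandermonde_sum {R : Type*} [CommRing R] (r s : ℕ)
    (w : Fin r ⊕ Fin s → R) :
    (Matrix.of fun i j : Fin r ⊕ Fin s => w j ^ (r + s - 1 - (finSumFinEquiv i : ℕ))).det =
      (Matrix.of fun i j : Fin r => w (.inl j) ^ (r - 1 - (i : ℕ))).det *
      (Matrix.of fun i j : Fin s => w (.inr j) ^ (s - 1 - (i : ℕ))).det *
      ∏ i, ∏ j, (w (.inl i) - w (.inr j)) := by
  have h : (Matrix.of fun i j : Fin r ⊕ Fin s => w j ^ (r + s - 1 - (finSumFinEquiv i : ℕ))) =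
      (Matrix.of fun i j : Fin (r + s) =>
        (w ∘ finSumFinEquiv.symm) j ^ (r + s - 1 - (i : ℕ))).submatrix
          finSumFinEquiv finSumFinEquiv := by
    ext i j
    simp
  have hlt (i : Fin r) (j : Fin s) : Fin.castAdd s i < Fin.natAdd r j := by
    simp [Fin.lt_def]; omega
  have hnlt (i : Fin r) (j : Fin s) : ¬ Fin.natAdd r j < Fin.castAdd s i := (hlt i j).not_gt
  rw [h, Matrix.det_submatrix_equiv_self]
  simp only [Matrix.det_descVandermonde, Fin.prod_univ_add, Function.comp_apply,
    finSumFinEquiv_symm_apply_castAdd, finSumFinEquiv_symm_apply_natAdd, hlt, hnlt, if_true,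
    if_false, Finset.prod_const_one, Finset.prod_mul_distrib]
  simp only [Fin.lt_def, Fin.val_castAdd, Fin.val_natAdd, add_lt_add_iff_left]
  ring

/-- A ratio of determinants occurring in the Laplace expansion of a bialternant, in terms of the
Schur polynomial of the selected variables. -/
theorem det_block_div_det_descVandermonde {K : Type*} [Field K] (r s M : ℕ) (lam : Fin r → ℕ)
    (z : Fin (r + s) → K) (hz : Function.Injective z) (I : Finset (Fin (r + s)))
    (hI : I.card = r) (S : Finset (Fin (r + s))) (hS : ∀ i, i ∈ S ↔ (i : ℕ) < r)
    (A : Matrix (Fin (r + s)) (Fin (r + s)) K)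
    (hA₁ : ∀ (i : Fin r) j, A (Fin.castAdd s i) j = z j ^ M * z j ^ (lam i + (r - 1 - (i : ℕ))))
    (hA₂ : ∀ (i : Fin s) j, A (Fin.natAdd r i) j = z j ^ (s - 1 - (i : ℕ))) :
    schurVal r lam (fun a => z (I.orderIsoOfFin hI a)) *
        ∏ i ∈ I, (z i ^ M / ∏ j ∈ Iᶜ, (z i - z j)) =
      (Matrix.of fun i j => if i ∈ S ↔ j ∈ I then A i j else 0).det /
      (Matrix.of fun i j : Fin (r + s) => z j ^ (r + s - 1 - (i : ℕ))).det := by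
  have hIc : Iᶜ.card = s := by simp [Finset.card_compl, hI]
  set e := finSumEquivOfFinset hI hIc with he
  have hel (a : Fin r) : e (.inl a) ∈ I := by simp [he]
  have her (a : Fin s) : e (.inr a) ∉ I := by
    have := Finset.orderEmbOfFin_mem Iᶜ hIc a
    simpa only [he, finSumEquivOfFinset_inr, Finset.mem_compl] using this
  have hprodI (g : Fin (r + s) → K) : ∏ i ∈ I, g i = ∏ a : Fin r, g (e (.inl a)) := by
    rw [← Finset.prod_coe_sort, ← (I.orderIsoOfFin hI).toEquiv.prod_comp]
    rfl
  have hprodIc (g : Fin (r + s) → K) : ∏ i ∈ Iᶜ, g i = ∏ a : Fin s, g (e (.inr a)) := by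
    rw [← Finset.prod_coe_sort, ← (Iᶜ.orderIsoOfFin hIc).toEquiv.prod_comp]
    rfl
  have hsign : ((Equiv.Perm.sign (e.trans finSumFinEquiv.symm) : ℤ) : K) ≠ 0 := by
    rcases Int.units_eq_one_or (Equiv.Perm.sign (e.trans finSumFinEquiv.symm)) with h | h <;>
      simp [h]
  rw [← mul_div_mul_left _ _ hsign, ← Matrix.det_submatrix_equiv_equiv,
    ← Matrix.det_submatrix_equiv_equiv]
  have hV : (Matrix.of fun i j : Fin (r + s) => z j ^ (r + s - 1 - (i : ℕ))).submatrix
      finSumFinEquiv e = Matrix.of fun i j : Fin r ⊕ Fin s =>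
        (z ∘ e) j ^ (r + s - 1 - (finSumFinEquiv i : ℕ)) := rfl
  have hB : (Matrix.of fun i j => if i ∈ S ↔ j ∈ I then A i j else 0).submatrix
      finSumFinEquiv e = Matrix.fromBlocks
        (Matrix.of fun i j : Fin r => z (e (.inl j)) ^ M *
          (Matrix.of fun i j : Fin r => z (e (.inl j)) ^ (lam i + (r - 1 - (i : ℕ)))) i j) 0 0
        (Matrix.of fun i j : Fin s => z (e (.inr j)) ^ (s - 1 - (i : ℕ))) := by
    ext (i | i) (j | j) <;> simp [hS, hel, her, hA₁, hA₂]
  have h₁ : Function.Injective fun a : Fin r => z (e (.inl a)) :=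
    hz.comp (e.injective.comp Sum.inl_injective)
  have h₂ : Function.Injective fun a : Fin s => z (e (.inr a)) :=
    hz.comp (e.injective.comp Sum.inr_injective)
  rw [hV, hB, Matrix.det_descVandermonde_sum, Matrix.det_fromBlocks_zero₂₁, Matrix.det_mul_row,
    hprodI]
  simp only [hprodIc, Finset.prod_div_distrib]
  change Matrix.det (Matrix.of fun i j : Fin r => z (e (.inl j)) ^ (lam i + (r - 1 - (i : ℕ)))) /
    Matrix.det (Matrix.of fun i j : Fin r => z (e (.inl j)) ^ (r - 1 - (i : ℕ))) * _ = _
  have hd₁ := Matrix.det_descVandermonde_ne_zero h₁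
  have hd₂ := Matrix.det_descVandermonde_ne_zero h₂
  have hd₃ : ∏ i : Fin r, ∏ j : Fin s, (z (e (.inl i)) - z (e (.inr j))) ≠ 0 :=
    Finset.prod_ne_zero_iff.2 fun i _ => Finset.prod_ne_zero_iff.2 fun j _ =>
      sub_ne_zero.2 (hz.ne (e.injective.ne (by simp)))
  simp only [Function.comp_apply]
  field_simp

/-- For pairwise distinct `z_1,…,z_N` in a field, a partition `λ` with `r`
parts and an integer `m` with `m + N - r ≥ 0`,
`Σ_{|I| = r} s_λ((z_i)_{i∈I}) ∏_{i∈I} (z_i^{m+N-r} / ∏_{j∉I}(z_i - z_j)) = s_a(z_1,…,z_N)`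
where `a = (λ_1 + m, …, λ_r + m, 0, …, 0)`. -/
theorem stmt1 {K : Type*} [Field K] (N r : ℕ) (hr : 1 ≤ r) (hrN : r ≤ N)
    (z : Fin N → K) (hz : Function.Injective z)
    (lam : Fin r → ℕ) (hlam : Antitone lam)
    (m : ℤ) (hm : 0 ≤ m + (N : ℤ) - (r : ℤ)) :
    ∑ I ∈ (Finset.powersetCard r (Finset.univ : Finset (Fin N))).attach,
        schurVal r lam
            (fun a => z ((I.1.orderIsoOfFin (Finset.mem_powersetCard.mp I.2).2 a : Fin N))) *
          ∏ i ∈ I.1, (z i ^ (m + (N : ℤ) - (r : ℤ)) / ∏ j ∈ I.1ᶜ, (z i - z j)) =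
      genSchurVal N (fun i => if h : (i : ℕ) < r then (lam ⟨i, h⟩ : ℤ) + m else 0) z := by
  obtain ⟨s, rfl⟩ := Nat.exists_eq_add_of_le hrN
  obtain ⟨M, hM⟩ := Int.eq_ofNat_of_zero_le hm
  let S : Finset (Fin (r + s)) := Finset.univ.filter fun i => (i : ℕ) < r
  have hS (i : Fin (r + s)) : i ∈ S ↔ (i : ℕ) < r := by simp [S]
  have hScard : S.card = r := by
    have : S = Finset.univ.map (Fin.castAddEmb (n := r) s) := by
      ext i
      simp only [hS, Finset.mem_map, Finset.mem_univ, true_and]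
      exact ⟨fun h => ⟨⟨i, h⟩, rfl⟩, fun ⟨a, ha⟩ => ha ▸ a.2⟩
    simp [this]
  have hden : (Matrix.of fun i j : Fin (r + s) =>
      z j ^ (((r + s : ℕ) : ℤ) - 1 - ((i : ℕ) : ℤ))) =
      Matrix.of fun i j : Fin (r + s) => z j ^ (r + s - 1 - (i : ℕ)) := by
    ext i j
    rw [Matrix.of_apply, Matrix.of_apply, ← zpow_natCast]
    congr 1
    omega
  rw [genSchurVal, hden, Matrix.det_eq_sum_powersetCard_det _ S, hScard, Finset.sum_div,
    ← Finset.sum_attach (Finset.powersetCard r Finset.univ)]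
  refine Finset.sum_congr rfl fun I _ => ?_
  simp only [hM, zpow_natCast]
  refine det_block_div_det_descVandermonde r s M lam z hz I.1 _ S hS _ (fun i j => ?_)
    fun i j => ?_
  · rw [← pow_add, ← zpow_natCast]
    simp only [Matrix.of_apply, Fin.val_castAdd, i.2, dite_true, Fin.eta]
    congr 1
    push_cast at hM ⊢
    omega
  · rw [← zpow_natCast]
    simp only [Matrix.of_apply, Fin.val_natAdd, add_lt_iff_neg_left, not_lt_zero, dite_false]
    congr 1
    push_cast
    omega
end

section
/- Assume the roots setup with 1 ≤ r ≤ N. Let λ = (λ_1 ≥ … ≥ λ_r ≥ 0) be a partition with λ_1 ≥ 1, and let d ≥ 0 be an integer with d ≥ λ_1 − (N − r). Put a = (d − λ_r, d − λ_{r−1}, …, d − λ_1, 0, …, 0) ∈ ℤ^N (N − r trailing zeros; under the hypotheses all exponents a_i + N − i are nonnegative). Then every polynomial F ∈ ℚ[T] with F(τ) = s_a(z_1,…,z_N) has coefficient of T^d equal to 0. -/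
/-- A polynomial has weight at most `n` when, its variable being given weight `r`, each of its
monomials has weight at most `n`. -/
def WeightLE (r : ℕ) (p : Polynomial ℚ) (n : ℤ) : Prop :=
  ∀ k, p.coeff k ≠ 0 → (r : ℤ) * k ≤ n

namespace WeightLE

variable {r : ℕ} {p q : Polynomial ℚ} {m n : ℤ}

theorem zero : WeightLE r 0 n := fun k hk => absurd (Polynomial.coeff_zero k) hk

theorem C (c : ℚ) (hn : 0 ≤ n) : WeightLE r (Polynomial.C c) n := by
  intro k hk
  rw [Polynomial.coeff_C] at hk
  obtain rfl : k = 0 := by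
    by_contra h
    simp [h] at hk
  simpa using hn

theorem X : WeightLE r Polynomial.X r := by
  intro k hk
  rw [Polynomial.coeff_X] at hk
  obtain rfl : 1 = k := by
    by_contra h
    simp [h] at hk
  simp

theorem add (hp : WeightLE r p n) (hq : WeightLE r q n) : WeightLE r (p + q) n := by
  intro k hk
  by_cases h : p.coeff k = 0
  · exact hq k fun h' => hk (by rw [Polynomial.coeff_add, h, h', add_zero])
  · exact hp k h

theorem neg (hp : WeightLE r p n) : WeightLE r (-p) n := fun k hk =>
  hp k fun h => hk (by rw [Polynomial.coeff_neg, h, neg_zero])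

theorem mul (hp : WeightLE r p m) (hq : WeightLE r q n) : WeightLE r (p * q) (m + n) := by
  intro k hk
  rw [Polynomial.coeff_mul] at hk
  obtain ⟨⟨i, j⟩, hij, h⟩ := Finset.exists_ne_zero_of_sum_ne_zero hk
  have h₁ := hp i (left_ne_zero_of_mul h)
  have h₂ := hq j (right_ne_zero_of_mul h)
  rw [Finset.HasAntidiagonal.mem_antidiagonal] at hij
  dsimp only at hij
  subst hij
  push_cast
  linarith

theorem sum {ι : Type*} (s : Finset ι) (f : ι → Polynomial ℚ)
    (h : ∀ i ∈ s, WeightLE r (f i) n) : WeightLE r (∑ i ∈ s, f i) n :=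
  Finset.sum_induction f (WeightLE r · n) (fun _ _ => add) zero h

theorem prod {ι : Type*} (s : Finset ι) (f : ι → Polynomial ℚ) (w : ι → ℤ)
    (h : ∀ i ∈ s, WeightLE r (f i) (w i)) : WeightLE r (∏ i ∈ s, f i) (∑ i ∈ s, w i) := by
  classical
  induction s using Finset.induction_on with
  | empty => simpa using C (r := r) 1 le_rfl
  | insert a s ha ih =>
    rw [Finset.prod_insert ha, Finset.sum_insert ha]
    exact (h a (Finset.mem_insert_self a s)).mul
      (ih fun i hi => h i (Finset.mem_insert_of_mem hi))

theorem det {N : ℕ} (M : Matrix (Fin N) (Fin N) (Polynomial ℚ)) (u v : Fin N → ℤ)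
    (h : ∀ i j, WeightLE r (M i j) (u i - v j)) :
    WeightLE r M.det (∑ i, u i - ∑ j, v j) := by
  rw [Matrix.det_apply]
  refine sum _ _ fun σ _ => ?_
  have hσ : WeightLE r (∏ i, M (σ i) i) (∑ i, u i - ∑ j, v j) := by
    rw [← Equiv.sum_comp σ u, ← Finset.sum_sub_distrib]
    exact prod _ _ _ fun i _ => h _ _
  rcases Int.units_eq_one_or (Equiv.Perm.sign σ) with hs | hs
  · simpa [hs] using hσ
  · simpa [hs] using hσ.neg

end WeightLE

/-- If `z ^ N` is a combination of lower powers of `z` whose `j`-th coefficient has weight at most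
`N - j`, then `z ^ e` is such a combination with `j`-th coefficient of weight at most `e - j`. -/
theorem exists_weightLE_pow_eq_sum {K : Type*} [Field K] [CharZero K] {r n : ℕ} {τ : K} {S : Set K}
    (c : ℕ → Polynomial ℚ) (hc : ∀ j ≤ n, WeightLE r (c j) ((n : ℤ) + 1 - j))
    (hS : ∀ z ∈ S, z ^ (n + 1) = ∑ j ∈ Finset.range (n + 1), Polynomial.aeval τ (c j) * z ^ j)
    (e : ℕ) :
    ∃ g : ℕ → Polynomial ℚ, (∀ j ≤ n, WeightLE r (g j) ((e : ℤ) - j)) ∧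
      ∀ z ∈ S, z ^ e = ∑ j ∈ Finset.range (n + 1), Polynomial.aeval τ (g j) * z ^ j := by
  induction e with
  | zero =>
    refine ⟨fun j => if j = 0 then 1 else 0, fun j _ => ?_, fun z _ => ?_⟩
    · by_cases hj : j = 0
      · simpa [hj] using WeightLE.C (r := r) 1 le_rfl
      · simpa [hj] using WeightLE.zero
    · rw [Finset.sum_eq_single 0] <;> simp +contextual
  | succ e ih =>
    obtain ⟨g, hg, hz⟩ := ih
    refine ⟨fun j => (if j = 0 then 0 else g (j - 1)) + g n * c j, fun j hj => ?_, fun z hzS => ?_⟩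
    · refine WeightLE.add ?_ ?_
      · rcases j with _ | j
        · simpa using WeightLE.zero
        · have := hg j (by omega)
          simp only [Nat.add_one_ne_zero, if_false, Nat.add_sub_cancel]
          convert this using 1
          push_cast
          ring
      · convert (hg n le_rfl).mul (hc j hj) using 1
        push_cast
        ring
    · simp only [map_add, map_mul, add_mul, Finset.sum_add_distrib, mul_assoc]
      rw [← Finset.mul_sum, ← hS z hzS, pow_succ, hz z hzS, Finset.sum_range_succ,
        Finset.sum_range_succ' (n := n), add_mul, Finset.sum_mul]
      simp [pow_succ, mul_assoc]

theorem root_pow_eq_sum {K : Type*} [Field K] [CharZero K] {n r : ℕ} (hrN : r ≤ n + 1) (hr : 1 ≤ r)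
    {τ z : K} (h : (z - 1) ^ (n + 1) + (-1) ^ r * τ * z ^ (n + 1 - r) = 0) :
    z ^ (n + 1) = ∑ j ∈ Finset.range (n + 1), Polynomial.aeval τ
      (Polynomial.C (-((-1) ^ (n + 1 - j) * ((n + 1).choose j : ℚ))) +
        if j = n + 1 - r then Polynomial.C (-(-1) ^ r) * Polynomial.X else 0) * z ^ j := by
  rw [sub_eq_add_neg, add_pow, Finset.sum_range_succ] at h
  have h₁ : ∑ j ∈ Finset.range (n + 1), Polynomial.aeval τ
      (if j = n + 1 - r then Polynomial.C (-(-1 : ℚ) ^ r) * Polynomial.X else 0) * z ^ j =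
      -((-1) ^ r * τ * z ^ (n + 1 - r)) := by
    rw [Finset.sum_eq_single (n + 1 - r)]
    · simp
    · intro b _ hb
      simp [hb]
    · intro hb
      exact absurd (Finset.mem_range.2 (by omega)) hb
  have h₂ : ∑ j ∈ Finset.range (n + 1), Polynomial.aeval τ
      (Polynomial.C (-((-1 : ℚ) ^ (n + 1 - j) * ((n + 1).choose j : ℚ)))) * z ^ j =
      -∑ j ∈ Finset.range (n + 1), z ^ j * (-1) ^ (n + 1 - j) * ((n + 1).choose j : K) := by
    rw [← Finset.sum_neg_distrib]
    refine Finset.sum_congr rfl fun j _ => ?_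
    simp
    ring
  simp only [map_add, add_mul, Finset.sum_add_distrib] at *
  rw [h₁, h₂]
  simp at h
  linear_combination h

theorem det_zpow_rev_ne_zero {K : Type*} [Field K] {N : ℕ} {z : Fin N → K}
    (hz : Function.Injective z) :
    Matrix.det (Matrix.of fun i j : Fin N => z j ^ ((N : ℤ) - 1 - ((i : ℕ) : ℤ))) ≠ 0 := by
  have h : (Matrix.of fun i j : Fin N => z j ^ ((N : ℤ) - 1 - ((i : ℕ) : ℤ))) =
      (Matrix.vandermonde z).transpose.submatrix Fin.revPerm id := by
    ext i j
    have : (N : ℤ) - 1 - ((i : ℕ) : ℤ) = ((N - (i + 1) : ℕ) : ℤ) := by omega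
    rw [Matrix.of_apply, this, zpow_natCast]
    simp [Matrix.vandermonde_apply]
  rw [h, Matrix.det_permute, Matrix.det_transpose]
  refine mul_ne_zero ?_ (Matrix.det_vandermonde_ne_zero_iff.2 hz)
  rcases Int.units_eq_one_or (Equiv.Perm.sign (Fin.revPerm (n := N))) with hs | hs <;> simp [hs]

/-- A generalized Schur function with nonnegative exponents, evaluated at the roots, is a polynomial
in `τ` of weight at most the size of the exponent vector. -/
theorem exists_weightLE_aeval_eq_genSchurVal {K : Type*} [Field K] [CharZero K] {n r : ℕ}
    (hr : 1 ≤ r) (hrN : r ≤ n + 1) {τ : K} {z : Fin (n + 1) → K} (hz : Function.Injective z)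
    (hroot : ∀ i, (z i - 1) ^ (n + 1) + (-1) ^ r * τ * z i ^ (n + 1 - r) = 0)
    (a : Fin (n + 1) → ℤ) (ha : ∀ i, 0 ≤ a i + (n - (i : ℕ))) :
    ∃ G : Polynomial ℚ, WeightLE r G (∑ i, a i) ∧
      Polynomial.aeval τ G = genSchurVal (n + 1) a z := by
  choose e he using fun i => Int.eq_ofNat_of_zero_le (ha i)
  choose g hgw hg using exists_weightLE_pow_eq_sum (r := r) (n := n) (τ := τ) (S := Set.range z)
    (fun j => Polynomial.C (-((-1) ^ (n + 1 - j) * ((n + 1).choose j : ℚ))) +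
        if j = n + 1 - r then Polynomial.C (-(-1) ^ r) * Polynomial.X else 0)
    (by
      intro j hj
      refine (WeightLE.C _ (by omega)).add ?_
      split_ifs with h
      · convert (WeightLE.C (r := r) (-(-1) ^ r) le_rfl).mul WeightLE.X using 1
        omega
      · exact WeightLE.zero)
    (by
      rintro _ ⟨i, rfl⟩
      exact root_pow_eq_sum hrN hr (hroot i))
  let M : Matrix (Fin (n + 1)) (Fin (n + 1)) (Polynomial ℚ) :=
    Matrix.of fun i l => g (e i) (n - l)
  refine ⟨M.det, ?_, ?_⟩
  · have := WeightLE.det (r := r) M (fun i => e i) (fun l => n - (l : ℕ)) fun i l => by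
      have := hgw (e i) (n - l) (by omega)
      rwa [Nat.cast_sub (by omega)] at this
    convert this using 1
    rw [← Finset.sum_sub_distrib]
    refine Finset.sum_congr rfl fun i _ => ?_
    have := he i
    linarith
  · rw [genSchurVal, eq_div_iff (det_zpow_rev_ne_zero hz), AlgHom.map_det, ← Matrix.det_mul]
    congr 1
    ext i k
    have h₁ : a i + (((n + 1 : ℕ) : ℤ) - 1 - ((i : ℕ) : ℤ)) = (e i : ℤ) := by
      have := he i
      omega
    rw [Matrix.mul_apply, Matrix.of_apply, h₁, zpow_natCast, hg (e i) (z k) ⟨k, rfl⟩,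
      ← Finset.sum_range_reflect, Finset.sum_range]
    refine Finset.sum_congr rfl fun l _ => ?_
    have h₂ : ((n + 1 : ℕ) : ℤ) - 1 - ((l : ℕ) : ℤ) = ((n + 1 - 1 - l : ℕ) : ℤ) := by omega
    rw [Matrix.of_apply, h₂, zpow_natCast]
    simp [M]


/-- Roots setup: `z_1,…,z_N` pairwise distinct with
`∏ (X - z_i) = (X-1)^N + (-1)^r τ X^{N-r}`, `τ` transcendental over `ℚ`. For a nonempty
partition `λ` with `r` parts and `d ≥ λ_1 - (N - r)`, setting
`a = (d - λ_r, …, d - λ_1, 0, …, 0) ∈ ℤ^N`, every `F ∈ ℚ[T]` with `F(τ) = s_a(z)` has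
`coeff of T^d` equal to `0`. -/
theorem stmt3 {K : Type*} [Field K] [CharZero K] (N r : ℕ) (hr : 1 ≤ r) (hrN : r ≤ N)
    (τ : K) (hτ : Transcendental ℚ τ)
    (z : Fin N → K) (hz : Function.Injective z)
    (hroots : ∏ i, (Polynomial.X - Polynomial.C (z i)) =
      (Polynomial.X - Polynomial.C (1 : K)) ^ N +
        Polynomial.C ((-1 : K) ^ r * τ) * Polynomial.X ^ (N - r))
    (lam : Fin r → ℕ) (hlam : Antitone lam) (hlam1 : 1 ≤ lam ⟨0, hr⟩)
    (d : ℕ) (hd : (lam ⟨0, hr⟩ : ℤ) - ((N : ℤ) - (r : ℤ)) ≤ (d : ℤ)) :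
    ∀ F : Polynomial ℚ,
      Polynomial.aeval τ F =
        genSchurVal N
          (fun i => if h : (i : ℕ) < r then (d : ℤ) - lam ⟨r - 1 - (i : ℕ), by omega⟩ else 0) z →
      F.coeff d = 0 := by
  intro F hF
  obtain ⟨n, rfl⟩ : ∃ n, N = n + 1 := ⟨N - 1, by omega⟩
  have hroot : ∀ i, (z i - 1) ^ (n + 1) + (-1) ^ r * τ * z i ^ (n + 1 - r) = 0 := by
    intro i
    have h := congrArg (Polynomial.eval (z i)) hroots
    rw [Polynomial.eval_prod, Finset.prod_eq_zero (Finset.mem_univ i) (by simp)] at h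
    simpa using h.symm
  have hle : ∀ i : Fin r, lam i ≤ lam ⟨0, hr⟩ := fun i => hlam (Fin.mk_le_mk.2 (Nat.zero_le _))
  obtain ⟨G, hGw, hG⟩ := exists_weightLE_aeval_eq_genSchurVal hr hrN hz hroot
    (fun i => if h : (i : ℕ) < r then (d : ℤ) - lam ⟨r - 1 - (i : ℕ), by omega⟩ else 0)
    (by
      intro i
      split_ifs with h
      · have := hle ⟨r - 1 - (i : ℕ), by omega⟩
        push_cast at hd
        omega
      · omega)
  obtain rfl : F = G := transcendental_iff_injective.1 hτ (hF.trans hG.symm)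
  by_contra hne
  refine absurd (hGw d hne) (not_le.2 ?_)
  have hsum : ∑ i : Fin (n + 1), (if (i : ℕ) < r then (d : ℤ) else 0) = r * d := by
    rw [← Finset.sum_filter, Finset.sum_const, Fin.card_filter_val_lt, min_eq_right hrN,
      nsmul_eq_mul]
  rw [← hsum]
  refine Finset.sum_lt_sum (fun i _ => ?_) ⟨⟨r - 1, by omega⟩, Finset.mem_univ _, ?_⟩
  · split_ifs <;> omega
  · have h : r - 1 < r := by omega
    simp only [h, dif_pos, if_true, Nat.sub_self]
    omega
end

section
/- Let R be a commutative ring, let N ≥ r ≥ 1 and 1 ≤ m ≤ r be integers, let x_1,…,x_N ∈ R, and let t be an indeterminate. Define E : ℤ → R[t] by E(j) = e_j(x_1,…,x_N) for j ≠ r and E(r) = e_r(x_1,…,x_N) + t. For an integer d ≥ 0, let M be the (d+m)×(d+m) matrix over R[t] with entries M_{i,j} = E(r − i + j) for 1 ≤ i ≤ d and M_{i,j} = E(1 − i + j) for d+1 ≤ i ≤ d+m, for 1 ≤ j ≤ d+m. Then the coefficient of t^d in det(M) equals h_m(x_1,…,x_N) if m < r, and equals h_r(x_1,…,x_N) + (−1)^{r+1}·d·e_r(x_1,…,x_N)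 if m = r. -/
/-- The `j`-th elementary symmetric polynomial of `x_1,…,x_N`, indexed by `j : ℤ`
(it is `0` for `j < 0` or `j > N`, and `1` for `j = 0`). -/
def esymZ {R : Type*} [CommRing R] (N : ℕ) (x : Fin N → R) (j : ℤ) : R :=
  if 0 ≤ j then
    ∑ s ∈ Finset.powersetCard j.toNat (Finset.univ : Finset (Fin N)), ∏ i ∈ s, x i
  else 0

/-- The `m`-th complete homogeneous symmetric polynomial of `x_1,…,x_N`. -/
def hsymN {R : Type*} [CommRing R] (N : ℕ) (x : Fin N → R) (m : ℕ) : R :=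
  ∑ s ∈ (Finset.univ : Finset (Fin N)).sym m, ((Sym.toMultiset s).map x).prod

/-- `E : ℤ → R[t]` with `E(j) = e_j(x)` for `j ≠ r` and `E(r) = e_r(x) + t`. -/
noncomputable def Efun {R : Type*} [CommRing R] (N : ℕ) (x : Fin N → R) (r : ℕ)
    (j : ℤ) : Polynomial R :=
  if j = (r : ℤ) then Polynomial.C (esymZ N x j) + Polynomial.X
  else Polynomial.C (esymZ N x j)

/-- Splitting `h_{n+1}` over `insert a s` according to whether `a` occurs in the monomial. -/
theorem sum_sym_insert_succ {R ι : Type*} [CommRing R] [DecidableEq ι] (x : ι → R) {a : ι}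
    {s : Finset ι} (ha : a ∉ s) (n : ℕ) :
    ∑ p ∈ (insert a s).sym (n + 1), ((Sym.toMultiset p).map x).prod =
      ∑ p ∈ s.sym (n + 1), ((Sym.toMultiset p).map x).prod +
        x a * ∑ p ∈ (insert a s).sym n, ((Sym.toMultiset p).map x).prod := by
  rw [← Finset.sum_filter_add_sum_filter_not _ (fun p : Sym ι (n + 1) => a ∈ p), add_comm]
  congr 1
  · refine Finset.sum_congr ?_ fun _ _ => rfl
    ext p
    simp only [Finset.mem_filter, Finset.mem_sym_iff, Finset.mem_insert]
    constructor
    · rintro ⟨h, hp⟩ b hb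
      exact (h b hb).resolve_left (by rintro rfl; exact hp hb)
    · exact fun h => ⟨fun b hb => Or.inr (h b hb), fun hp => ha (h a hp)⟩
  · rw [Finset.mul_sum]
    symm
    refine Finset.sum_bij (fun p _ => a ::ₛ p) ?_ ?_ ?_ ?_
    · intro p hp
      simp only [Finset.mem_filter, Finset.mem_sym_iff, Sym.mem_cons] at hp ⊢
      refine ⟨?_, by simp⟩
      rintro b (rfl | hb)
      · simp
      · exact hp b hb
    · intro p _ q _ h
      exact Sym.cons_inj_right a p q |>.1 h
    · intro p hp
      simp only [Finset.mem_filter, Finset.mem_sym_iff] at hp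
      obtain ⟨q, rfl⟩ := Sym.exists_cons_of_mem hp.2
      exact ⟨q, Finset.mem_sym_iff.2 fun b hb => hp.1 b (Sym.mem_cons_of_mem hb), rfl⟩
    · intro p _
      rw [Sym.coe_cons, Multiset.map_cons, Multiset.prod_cons]

open PowerSeries in
/-- The generating series of the `h_n`, with alternating signs, is inverse to `∏ (1 + x_i T)`. -/
theorem prod_one_add_mul_mk_sum_sym {R ι : Type*} [CommRing R] [DecidableEq ι] (x : ι → R)
    (s : Finset ι) :
    (∏ i ∈ s, (1 + C (x i) * X)) *
      PowerSeries.mk (fun n => (-1 : R) ^ n *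
        ∑ p ∈ s.sym n, ((Sym.toMultiset p).map x).prod) = 1 := by
  induction s using Finset.induction_on with
  | empty =>
    ext n
    cases n with
    | zero => simp [show ((∅ : Sym ι 0) : Multiset ι) = 0 from rfl]
    | succ n => simp [coeff_one]
  | insert a s ha ih =>
    rw [Finset.prod_insert ha, mul_right_comm, mul_comm]
    refine Eq.trans ?_ ih
    congr 1
    ext n
    rw [add_mul, one_mul, map_add, mul_assoc, coeff_C_mul, mul_comm X]
    cases n with
    | zero => simp
    | succ n =>
      rw [coeff_succ_mul_X]
      simp only [coeff_mk]
      rw [sum_sym_insert_succ x ha]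
      ring

open PowerSeries in
theorem coeff_prod_one_add_C_mul_X {R ι : Type*} [CommRing R] [DecidableEq ι] (x : ι → R)
    (s : Finset ι) (n : ℕ) :
    coeff n (∏ i ∈ s, (1 + C (x i) * X)) = ∑ t ∈ s.powersetCard n, ∏ i ∈ t, x i := by
  rw [Finset.prod_one_add, map_sum, Finset.powersetCard_eq_filter, Finset.sum_filter]
  refine Finset.sum_congr rfl fun t _ => ?_
  rw [Finset.prod_mul_distrib, Finset.prod_const, ← map_prod, coeff_C_mul, coeff_X_pow]
  simp [eq_comm]

open PowerSeries Matrix in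
/-- The upper Hessenberg Toeplitz determinant built from a power series `f` with constant
coefficient `1` computes the coefficients of the inverse series. -/
theorem det_toeplitz_eq_coeff {R : Type*} [CommRing R] (a : ℤ → R) (f g : PowerSeries R)
    (hfg : f * g = 1) (ha : ∀ n : ℕ, a n = coeff n f) (h0 : a 0 = 1)
    (hneg : ∀ j < 0, a j = 0) (m : ℕ) :
    (Matrix.of fun i j : Fin m => a (1 - (i : ℕ) + (j : ℕ))).det = (-1) ^ m * coeff m g := by
  set U : Matrix (Fin (m + 1)) (Fin (m + 1)) R := Matrix.of fun i j => a ((j : ℕ) - (i : ℕ))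
    with hU
  have hdet : U.det = 1 := by
    rw [Matrix.det_of_isUpperTriangular]
    · simp [hU, h0]
    · intro i j hij
      exact hneg _ (by have : (j : ℕ) < i := hij; omega)
  have hUv : U *ᵥ (fun j : Fin (m + 1) => coeff (m - (j : ℕ)) g) = Pi.single (Fin.last m) 1 := by
    ext i
    have hi : Finset.range (m + 1) = Finset.range (i + (m - i + 1)) := by
      congr 1
      omega
    simp only [hU, Matrix.mulVec, dotProduct, Matrix.of_apply]
    rw [Fin.sum_univ_eq_sum_range (fun j => a ((j : ℤ) - (i : ℕ)) * coeff (m - j) g) (m + 1), hi,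
      Finset.sum_range_add, Finset.sum_eq_zero, zero_add]
    · have h := congrArg (coeff (m - (i : ℕ))) hfg
      rw [coeff_mul, Finset.Nat.sum_antidiagonal_eq_sum_range_succ_mk, coeff_one] at h
      rw [Finset.sum_congr rfl (g := fun k => coeff k f * coeff (m - (i : ℕ) - k) g), h]
      · simp only [Pi.single_apply, Fin.ext_iff, Fin.val_last]
        congr 1
        exact propext (by omega)
      · intro k _
        rw [← ha k, Nat.sub_add_eq]
        congr 2
        push_cast
        ring
    · intro k hk
      rw [hneg _ (by have := Finset.mem_range.1 hk; omega), zero_mul]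
  have hadj : U.adjugate 0 (Fin.last m) = coeff m g := by
    have := congrArg (fun v => (U.adjugate *ᵥ v) 0) hUv
    simpa [Matrix.mulVec_mulVec, Matrix.adjugate_mul, hdet] using this.symm
  rw [Matrix.adjugate_fin_succ_eq_det_submatrix] at hadj
  rw [← hadj, ← mul_assoc]
  simp only [Fin.val_last, Fin.val_zero, add_zero, ← mul_pow, neg_mul_neg, one_mul, one_pow]
  congr 1
  ext i j
  simp only [hU, Matrix.of_apply, Matrix.submatrix_apply, Fin.succAbove_last, Fin.succAbove_zero,
    Fin.val_succ, Fin.val_castSucc]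
  congr 1
  push_cast
  ring

open Polynomial in
/-- If the indeterminate occurs only on the diagonal of the upper left `d × d` block, then the
coefficient of its `d`-th power in the determinant is the determinant of the opposite block. -/
theorem coeff_det_fromBlocks_X_add {R n p : Type*} [CommRing R] [Fintype n] [Fintype p]
    [DecidableEq n] [DecidableEq p] (A : Matrix n n R) (B : Matrix n p R) (D : Matrix p n R)
    (E : Matrix p p R) :
    (Matrix.fromBlocks ((X : R[X]) • 1 + A.map C) (B.map C) (D.map C) (E.map C)).det.coeff
      (Fintype.card n) = E.det := by
  have h := Polynomial.coeff_det_X_add_C_card (Matrix.fromBlocks 1 0 D E)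
    (Matrix.fromBlocks A B 0 0)
  rw [Matrix.det_fromBlocks_zero₁₂, Matrix.det_one, one_mul] at h
  rw [← h]
  have h2 : (X : R[X]) • (Matrix.fromBlocks 1 0 D E).map C + (Matrix.fromBlocks A B 0 0).map C =
      Matrix.fromBlocks 1 0 0 ((X : R[X]) • 1) *
        Matrix.fromBlocks ((X : R[X]) • 1 + A.map C) (B.map C) (D.map C) (E.map C) := by
    rw [Matrix.fromBlocks_multiply]
    simp [Matrix.fromBlocks_map, Matrix.fromBlocks_smul, Matrix.fromBlocks_add]
  rw [h2, Matrix.det_mul, Matrix.det_fromBlocks_zero₁₂, Matrix.det_one, one_mul,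
    Matrix.det_smul, Matrix.det_one, mul_one, Fintype.card_sum, add_comm,
    ← Polynomial.coeff_X_pow_mul]

theorem det_esymZ_eq_hsymN {R : Type*} [CommRing R] (N m : ℕ) (x : Fin N → R) :
    (Matrix.of fun i j : Fin m => esymZ N x (1 - (i : ℕ) + (j : ℕ))).det = hsymN N x m := by
  rw [det_toeplitz_eq_coeff (esymZ N x) _ _ (prod_one_add_mul_mk_sum_sym x Finset.univ)
    (fun n => by simp [coeff_prod_one_add_C_mul_X, esymZ]) (by simp [esymZ])
    (fun j hj => by simp [esymZ, hj.not_ge]), PowerSeries.coeff_mk, ← mul_assoc, ← mul_pow]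
  simp [hsymN]

open Polynomial in
/-- The matrix with rows `a (r - i + j)` for `i < d` and `a (1 - i + j)` for `d ≤ i`, with the
indeterminate added to its first `d` diagonal entries. -/
noncomputable def stableMatrix {R : Type*} [CommRing R] (a : ℤ → R) (r d m : ℕ) :
    Matrix (Fin (d + m)) (Fin (d + m)) R[X] :=
  Matrix.of fun i j =>
    if (i : ℕ) < d then
      C (a (r - (i : ℕ) + (j : ℕ))) + if i = j then X else 0
    else C (a (1 - (i : ℕ) + (j : ℕ)))

open Polynomial in
theorem coeff_det_stableMatrix {R : Type*} [CommRing R] (a : ℤ → R) (r d m : ℕ) :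
    (stableMatrix a r d m).det.coeff d =
      (Matrix.of fun i j : Fin m => a (1 - (i : ℕ) + (j : ℕ))).det := by
  rw [← coeff_det_fromBlocks_X_add
      (Matrix.of fun i j : Fin d => a (r - (i : ℕ) + (j : ℕ)))
      (Matrix.of fun (i : Fin d) (j : Fin m) => a (r - (i : ℕ) + (d + j : ℕ)))
      (Matrix.of fun (i : Fin m) (j : Fin d) => a (1 - (d + i : ℕ) + (j : ℕ))),
    ← Matrix.det_submatrix_equiv_self finSumFinEquiv (stableMatrix a r d m), Fintype.card_fin]
  congr 2
  ext1 i j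
  rcases i with i | i <;> rcases j with j | j
  · simp [stableMatrix, Matrix.one_apply, add_comm, mul_ite]
  · have : Fin.castAdd m i ≠ Fin.natAdd d j := by
      intro h
      have := congrArg Fin.val h
      simp at this
      omega
    simp [stableMatrix, this]
  · simp [stableMatrix]
  · simp only [stableMatrix, Matrix.submatrix_apply, Matrix.of_apply, finSumFinEquiv_apply_right,
      Matrix.fromBlocks_apply₂₂, Matrix.map_apply, Fin.val_natAdd]
    rw [if_neg (by omega)]
    congr 2
    push_cast
    ring

open Polynomial in
/-- Replacing the first row below the top block by the last coordinate vector leaves a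
characteristic polynomial, up to sign. -/
theorem det_stableMatrix_updateRow {R : Type*} [CommRing R] (a : ℤ → R) (r d k : ℕ)
    (h0 : a 0 = 1) (hneg : ∀ j < 0, a j = 0) :
    ((stableMatrix a r d (k + 1)).updateRow (Fin.natAdd d 0)
        (Pi.single (Fin.natAdd d (Fin.last k)) 1)).det =
      (-1) ^ k * (-Matrix.of fun i j : Fin d => a (r - (i : ℕ) + (j : ℕ))).charpoly := by
  rw [← Matrix.adjugate_apply]
  refine (Matrix.adjugate_fin_succ_eq_det_submatrix (n := d + k) _ _ _).trans ?_
  have hsign : ((-1 : R[X]) ^ ((Fin.natAdd d (0 : Fin (k + 1)) : ℕ) +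
      (Fin.natAdd d (Fin.last k) : ℕ))) = (-1) ^ k := by
    simp [← add_assoc, pow_add, ← mul_pow]
  rw [hsign, ← Matrix.det_submatrix_equiv_self finSumFinEquiv]
  congr 1
  have hl (i : Fin d) :
      (Fin.succAbove (n := d + k) (Fin.natAdd d (0 : Fin (k + 1))) (Fin.castAdd k i) : ℕ) = i := by
    rw [Fin.succAbove_of_castSucc_lt]
    · simp
    · simp [Fin.lt_def]
  have hr (i : Fin k) :
      (Fin.succAbove (n := d + k) (Fin.natAdd d (0 : Fin (k + 1))) (Fin.natAdd d i) : ℕ) =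
        d + i + 1 := by
    rw [Fin.succAbove_of_le_castSucc]
    · simp
    · simp [Fin.le_def]
  rw [← Matrix.fromBlocks_toBlocks (Matrix.submatrix (Matrix.submatrix _ _ _) _ _)]
  rw [show Matrix.toBlocks₂₁ _ = (0 : Matrix (Fin k) (Fin d) R[X]) from ?_,
    Matrix.det_fromBlocks_zero₂₁, Matrix.det_of_isUpperTriangular (M := Matrix.toBlocks₂₂ _) ?_,
    Finset.prod_eq_one, mul_one, Matrix.charpoly]
  · congr 1
    ext1 i j
    simp [Matrix.toBlocks₁₁, stableMatrix, hl, Matrix.charmatrix_apply, Matrix.diagonal_apply,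
      Fin.ext_iff, add_comm]
  · intro i _
    have hi : (1 - ((d : ℤ) + ((i : ℕ) + 1)) + (d + (i : ℕ))) = 0 := by ring
    simp [Matrix.toBlocks₂₂, stableMatrix, hr, hi, h0, add_assoc]
  · intro i j hij
    have hij' : (j : ℕ) < i := hij
    have ha := hneg (1 - ((d : ℤ) + ((i : ℕ) + 1)) + (d + (j : ℕ))) (by omega)
    simp [Matrix.toBlocks₂₂, stableMatrix, hr, ha, add_assoc]
  · ext1 i j
    have ha := hneg (1 - ((d : ℤ) + ((i : ℕ) + 1)) + (j : ℕ)) (by omega)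
    simp [Matrix.toBlocks₂₁, stableMatrix, hr, ha, add_assoc]

/-- Let `M` be the `(d+m)×(d+m)` matrix over `R[t]` with
`M_{i,j} = E(r - i + j)` for `1 ≤ i ≤ d` and `M_{i,j} = E(1 - i + j)` for
`d+1 ≤ i ≤ d+m`. Then the coefficient of `t^d` in `det M` is `h_m(x)` if `m < r` and
`h_r(x) + (-1)^{r+1}·d·e_r(x)` if `m = r`. -/
theorem stmt6 {R : Type*} [CommRing R] (N r m : ℕ) (hr : 1 ≤ r) (hrN : r ≤ N)
    (hm1 : 1 ≤ m) (hm : m ≤ r) (x : Fin N → R) (d : ℕ) :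
    (Matrix.det (Matrix.of fun i j : Fin (d + m) =>
        if (i : ℕ) < d then Efun N x r ((r : ℤ) - ((i : ℕ) : ℤ) + ((j : ℕ) : ℤ))
        else Efun N x r ((1 : ℤ) - ((i : ℕ) : ℤ) + ((j : ℕ) : ℤ)))).coeff d =
      if m < r then hsymN N x m
      else hsymN N x r + (-1 : R) ^ (r + 1) * (d : R) * esymZ N x (r : ℤ) := by
  obtain ⟨k, rfl⟩ : ∃ k, m = k + 1 := ⟨m - 1, by omega⟩
  have h0 : esymZ N x 0 = 1 := by simp [esymZ]
  have hneg : ∀ j < 0, esymZ N x j = 0 := fun j hj => by simp [esymZ, hj.not_ge]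
  split_ifs with hmr
  · rw [← det_esymZ_eq_hsymN, ← coeff_det_stableMatrix (esymZ N x) r d]
    congr 2
    ext1 i j
    simp only [Matrix.of_apply, stableMatrix, Efun, Fin.ext_iff]
    split_ifs <;> first | omega | simp
  · obtain rfl : r = k + 1 := by omega
    have hM : (Matrix.of fun i j : Fin (d + (k + 1)) =>
        if (i : ℕ) < d then
          Efun N x (k + 1) (((k + 1 : ℕ) : ℤ) - ((i : ℕ) : ℤ) + ((j : ℕ) : ℤ))
        else Efun N x (k + 1) ((1 : ℤ) - ((i : ℕ) : ℤ) + ((j : ℕ) : ℤ))) =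
        (stableMatrix (esymZ N x) (k + 1) d (k + 1)).updateRow (Fin.natAdd d 0)
          (stableMatrix (esymZ N x) (k + 1) d (k + 1) (Fin.natAdd d 0) +
            (Polynomial.X : Polynomial R) • Pi.single (Fin.natAdd d (Fin.last k)) 1) := by
      ext1 i j
      simp only [Matrix.of_apply, stableMatrix, Efun, Fin.ext_iff, Matrix.updateRow_apply,
        Pi.add_apply, Pi.smul_apply, Pi.single_apply, Fin.val_natAdd, Fin.val_last, Fin.val_zero]
      split_ifs <;> first | omega | (simp_all; done) | (simp_all; intros; omega)
    rw [hM, Matrix.det_updateRow_add, Matrix.det_updateRow_smul, Matrix.updateRow_eq_self,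
      det_stableMatrix_updateRow _ _ _ _ h0 hneg, Polynomial.coeff_add, coeff_det_stableMatrix,
      det_esymZ_eq_hsymN]
    congr 1
    cases d with
    | zero => simp
    | succ d =>
      have ht : (-Matrix.of fun i j : Fin (d + 1) =>
          esymZ N x ((k + 1 : ℕ) - (i : ℕ) + (j : ℕ))).charpoly.coeff d =
            (d + 1 : ℕ) * esymZ N x (k + 1 : ℕ) := by
        have h := Matrix.trace_eq_neg_charpoly_coeff (-Matrix.of fun i j : Fin (d + 1) =>
          esymZ N x ((k + 1 : ℕ) - (i : ℕ) + (j : ℕ)))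
        rw [Fintype.card_fin, Nat.add_sub_cancel, eq_comm, neg_eq_iff_eq_neg] at h
        rw [h]
        simp [Matrix.trace]
      have hs : (-1 : Polynomial R) ^ k = Polynomial.C ((-1) ^ k) := by simp
      rw [hs, Polynomial.coeff_X_mul, Polynomial.coeff_C_mul, ht]
      ring
end

section
/- Assume the roots setup with 1 ≤ r ≤ N. Let λ = (λ_1 ≥ … ≥ λ_r ≥ 0) be a partition and d ≥ 0 an integer, and set f_i(z) = z^d (1 − z^{-1})^{λ_i + r − i} for 1 ≤ i ≤ r. Assume that either (i) d ≥ λ_1 − (N − r), or (ii) r < N, d ≥ r, and λ_1 ≤ 2(N − r) + r. Then every polynomial F ∈ ℚ[T] with F(τ) = s_{(f_1,…,f_r)}(z_1,…,z_N) has coefficient of T^d equal to 1. -/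
/-- The generalized Schur function `s_{(f_1,…,f_r)}(z_1,…,z_N)` attached to functions
`f_1,…,f_r`: `det(M) / det(z_j^{N-i})` where `M_{i,j} = f_i(z_j)·z_j^{N-i}` for `i ≤ r`
and `M_{i,j} = z_j^{N-i}` for `i > r`. -/
noncomputable def genSchurFun {K : Type*} [Field K] (N r : ℕ) (f : Fin r → K → K)
    (z : Fin N → K) : K :=
  Matrix.det (Matrix.of fun i j : Fin N =>
      (if h : (i : ℕ) < r then f ⟨i, h⟩ (z j) else 1) * z j ^ ((N : ℤ) - 1 - ((i : ℕ) : ℤ))) /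
  Matrix.det (Matrix.of fun i j : Fin N => z j ^ ((N : ℤ) - 1 - ((i : ℕ) : ℤ)))

open Polynomial

/-- Binomial coefficients with integer arguments, zero when the lower argument is negative. -/
noncomputable def intChoose (x k : ℤ) : ℤ :=
  if 0 ≤ k then Ring.choose x k.toNat else 0

theorem intChoose_of_neg {x k : ℤ} (hk : k < 0) : intChoose x k = 0 :=
  if_neg (not_le.2 hk)

theorem intChoose_succ (x k : ℤ) :
    intChoose (x + 1) k = intChoose x (k - 1) + intChoose x k := by
  rcases lt_trichotomy k 0 with hk | rfl | hk
  · rw [intChoose_of_neg hk, intChoose_of_neg hk, intChoose_of_neg (by lia), add_zero]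
  · rw [intChoose_of_neg (k := 0 - 1) (by lia)]
    simp [intChoose]
  · obtain ⟨m, rfl⟩ : ∃ m : ℕ, k = m + 1 := ⟨(k - 1).toNat, by lia⟩
    have h1 : ((m : ℤ) + 1).toNat = m + 1 := by lia
    simp only [intChoose, add_sub_cancel_right, Int.toNat_natCast, h1]
    rw [if_pos hk.le, if_pos (by lia), if_pos hk.le, Ring.choose_succ_succ]

theorem intChoose_eq_zero_of_lt {x k : ℤ} (hx : 0 ≤ x) (hk : x < k) : intChoose x k = 0 := by
  lift x to ℕ using hx
  lift k to ℕ using by lia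
  simp only [intChoose, Int.toNat_natCast, Ring.choose_natCast]
  simp [Nat.choose_eq_zero_of_lt (by exact_mod_cast hk : x < k)]

theorem intChoose_self {x : ℤ} (hx : 0 ≤ x) : intChoose x x = 1 := by
  lift x to ℕ using hx
  simp [intChoose, Ring.choose_natCast]

/-- The coefficient of `τ ^ n` in the sum of the residues of
`z ^ a * (z - 1) ^ b / ((z - 1) ^ (r + E) + (-1) ^ r * τ * z ^ E)` at the roots of the
denominator. -/
noncomputable def residueCoeff (r E : ℕ) (a : ℤ) (b n : ℕ) : ℚ :=
  ((-1) ^ (r - 1)) ^ n * (intChoose (a + E * n) ((r + E) * (n + 1) - 1 - b) : ℤ)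

theorem residueCoeff_succ_left (r E : ℕ) (a : ℤ) (b n : ℕ) :
    residueCoeff r E (a + 1) b n = residueCoeff r E a b n + residueCoeff r E a (b + 1) n := by
  unfold residueCoeff
  rw [← mul_add, ← Int.cast_add, add_right_comm, intChoose_succ, add_comm (intChoose _ _)]
  congr 4
  push_cast
  ring_nf

theorem residueCoeff_add_zero (r E : ℕ) (a : ℤ) (b : ℕ) :
    residueCoeff r E a (b + (r + E)) 0 = 0 := by
  unfold residueCoeff
  rw [intChoose_of_neg (by push_cast; lia)]
  simp

theorem residueCoeff_add_succ (r E : ℕ) (a : ℤ) (b n : ℕ) :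
    residueCoeff r E a (b + (r + E)) (n + 1) =
      (-1) ^ (r - 1) * residueCoeff r E (a + E) b n := by
  unfold residueCoeff
  rw [pow_succ', mul_assoc]
  congr 4
  · push_cast; ring
  · push_cast; ring

theorem residueCoeff_zero_left {r E : ℕ} (hr : 1 ≤ r) {b : ℕ} (hb : b < r + E) (n : ℕ) :
    residueCoeff r E 0 b n = if b = r + E - 1 ∧ n = 0 then 1 else 0 := by
  unfold residueCoeff
  split_ifs with h
  · obtain ⟨rfl, rfl⟩ := h
    have : ((r : ℤ) + E) * ((0 : ℕ) + 1) - 1 - ((r + E - 1 : ℕ) : ℤ) = 0 + E * (0 : ℕ) := by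
      push_cast [Nat.cast_sub (by lia : 1 ≤ r + E)]; ring
    rw [this, intChoose_self (by simp)]
    simp
  · rw [intChoose_eq_zero_of_lt (by positivity)]
    · simp
    · rcases Nat.eq_zero_or_pos n with rfl | hn
      · push_cast; lia
      · have : 1 * 1 ≤ r * n := Nat.mul_le_mul hr hn
        zify at this hb
        nlinarith

section Interpolation

variable {K : Type*} [Field K]

/-- A family indexed by `ℤ × ℕ` obeying the relations of `z ^ a * (z - 1) ^ b` modulo
`(z - 1) ^ (r + E) + (-1) ^ r * τ * z ^ E` is polynomial in `τ` with coefficients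
`residueCoeff`. -/
theorem exists_polynomial_coeff_eq_residueCoeff [CharZero K] {r E : ℕ} (hr : 1 ≤ r) (τ : K)
    (x : ℤ → ℕ → K)
    (hsucc : ∀ a b, x (a + 1) b = x a b + x a (b + 1))
    (hadd : ∀ a b, x a (b + (r + E)) = (-1) ^ (r - 1) * τ * x (a + E) b)
    (hzero : ∀ b < r + E, x 0 b = if b = r + E - 1 then 1 else 0)
    (a : ℤ) (b : ℕ) (ha : 0 ≤ a ∨ 1 ≤ E) :
    ∃ p : ℚ[X], aeval τ p = x a b ∧ ∀ n, p.coeff n = residueCoeff r E a b n := by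
  set good : ℤ → ℕ → Prop := fun a b =>
    ∃ p : ℚ[X], aeval τ p = x a b ∧ ∀ n, p.coeff n = residueCoeff r E a b n
  have good_succ : ∀ a b, good a b → good a (b + 1) → good (a + 1) b := by
    rintro a b ⟨p, hp, hp'⟩ ⟨q, hq, hq'⟩
    refine ⟨p + q, ?_, fun n => ?_⟩
    · rw [map_add, hp, hq, hsucc]
    · rw [coeff_add, hp', hq', residueCoeff_succ_left]
  have good_pred : ∀ a b, good (a + 1) b → good a (b + 1) → good a b := by
    rintro a b ⟨p, hp, hp'⟩ ⟨q, hq, hq'⟩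
    refine ⟨p - q, ?_, fun n => ?_⟩
    · rw [map_sub, hp, hq, hsucc, add_sub_cancel_right]
    · rw [coeff_sub, hp', hq', residueCoeff_succ_left, add_sub_cancel_right]
  have good_add : ∀ a b, good (a + E) b → good a (b + (r + E)) := by
    rintro a b ⟨p, hp, hp'⟩
    refine ⟨C ((-1) ^ (r - 1)) * (X * p), ?_, fun n => ?_⟩
    · simp [hp, hadd, mul_assoc]
    · rw [coeff_C_mul]
      cases n with
      | zero => simp [residueCoeff_add_zero]
      | succ n => rw [coeff_X_mul, hp', residueCoeff_add_succ]
  have good_zero : ∀ b < r + E, good 0 b := by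
    intro b hb
    refine ⟨C (if b = r + E - 1 then 1 else 0), ?_, fun n => ?_⟩
    · rw [hzero b hb]; split_ifs <;> simp
    · rw [residueCoeff_zero_left hr hb, coeff_C]
      split_ifs <;> simp_all
  have good_nonneg : ∀ s a b : ℕ, a + b = s → good a b := by
    intro s
    induction s using Nat.strong_induction_on with
    | _ s ihs =>
      intro a
      induction a with
      | zero =>
        intro b hb
        by_cases hbN : b < r + E
        · exact_mod_cast good_zero b hbN
        · obtain ⟨b, rfl⟩ : ∃ c, b = c + (r + E) := ⟨b - (r + E), by lia⟩
          have := ihs (E + b) (by lia) E b rfl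
          apply good_add
          simpa using this
      | succ a iha =>
        intro b hb
        have := good_succ a b (ihs (a + b) (by lia) a b rfl) (iha (b + 1) (by lia))
        exact_mod_cast this
  rcases ha with ha | hE
  · lift a to ℕ using ha
    exact good_nonneg _ a b rfl
  · have good_neg : ∀ m : ℕ, ∀ a : ℤ, -(m : ℤ) ≤ a → ∀ b, good a b := by
      intro m
      induction m with
      | zero =>
        intro a ha b
        lift a to ℕ using by simpa using ha
        exact good_nonneg _ a b rfl
      | succ m ihm =>
        intro a ha b
        push_cast at ha
        have descend : ∀ k, good a (b + k) → good a b := by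
          intro k
          induction k with
          | zero => exact id
          | succ k ihk => exact fun h => ihk (good_pred a (b + k) (ihm _ (by lia) _) h)
        exact descend _ (good_add a b (ihm _ (by lia) _))
    exact good_neg a.natAbs a (by lia) b

/-- Weights of the linear functional extracting the coefficient of degree `N - 1` from the values
of a polynomial of degree less than `N`. -/
theorem exists_weights_sum_eval_eq_coeff {N : ℕ} (hN : 1 ≤ N) {z : Fin N → K}
    (hz : Function.Injective z) :
    ∃ w : Fin N → K, ∀ p : K[X], p.natDegree < N →
      ∑ j, w j * p.eval (z j) = p.coeff (N - 1) := by
  classical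
  let V := Matrix.vandermonde z
  have hV : IsUnit V.det := (Matrix.det_vandermonde_ne_zero_iff.2 hz).isUnit
  let e : Fin N → K := Pi.single ⟨N - 1, by lia⟩ 1
  refine ⟨Matrix.vecMul e V⁻¹, fun p hp => ?_⟩
  have heval : (fun j => p.eval (z j)) = V.mulVec (fun i => p.coeff i) := by
    funext j
    rw [eval_eq_sum_range' hp, Finset.sum_range]
    simp [Matrix.mulVec, dotProduct, V, Matrix.vandermonde_apply, mul_comm]
  change dotProduct (Matrix.vecMul e V⁻¹) (fun j => p.eval (z j)) = _
  rw [heval, ← Matrix.dotProduct_mulVec, Matrix.mulVec_mulVec, Matrix.nonsing_inv_mul _ hV,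
    Matrix.one_mulVec, single_one_dotProduct]

theorem sum_weights_mul_pow {N : ℕ} {z w : Fin N → K}
    (hw : ∀ p : K[X], p.natDegree < N → ∑ j, w j * p.eval (z j) = p.coeff (N - 1))
    {a b : ℕ} (hab : a + b < N) :
    ∑ j, w j * (z j ^ a * (z j - 1) ^ b) = if a + b = N - 1 then 1 else 0 := by
  have hmonic : (X ^ a * (X - C (1 : K)) ^ b).Monic :=
    (monic_X_pow a).mul ((monic_X_sub_C 1).pow b)
  have hdeg : (X ^ a * (X - C (1 : K)) ^ b).natDegree = a + b := by
    rw [(monic_X_pow a).natDegree_mul ((monic_X_sub_C 1).pow b), natDegree_X_pow,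
      (monic_X_sub_C 1).natDegree_pow, natDegree_X_sub_C, mul_one]
  have h := hw _ (hdeg.trans_lt hab)
  simp only [eval_mul, eval_pow, eval_X, eval_sub, eval_C] at h
  rw [h]
  split_ifs with heq
  · rw [← heq, ← hdeg]
    exact hmonic.coeff_natDegree
  · exact coeff_eq_zero_of_natDegree_lt (by lia)

/-- A generalized Schur function as an `r × r` determinant of moments. -/
theorem genSchurFun_eq_det {r E : ℕ} (f : Fin r → K → K) {z w : Fin (r + E) → K}
    (hw : ∀ p : K[X], p.natDegree < r + E → ∑ j, w j * p.eval (z j) = p.coeff (r + E - 1)) :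
    genSchurFun (r + E) r f z = Matrix.det (Matrix.of fun i l : Fin r =>
      ∑ j, w j * (f i (z j) * z j ^ (((r + E : ℕ) : ℤ) - 1 - (i : ℕ)) * (z j - 1) ^ (l : ℕ))) := by
  let W : Matrix (Fin (r + E)) (Fin (r + E)) K := .of fun j l => w j * (z j - 1) ^ (l : ℕ)
  have moment : ∀ i l : Fin (r + E), l ≤ i →
      ∑ j, z j ^ (((r + E : ℕ) : ℤ) - 1 - (i : ℕ)) * (w j * (z j - 1) ^ (l : ℕ)) =
        if l = i then 1 else 0 := by
    intro i l hli
    have hli' : (l : ℕ) ≤ i := hli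
    have hexp : ((r + E : ℕ) : ℤ) - 1 - (i : ℕ) = ((r + E - 1 - i : ℕ) : ℤ) := by lia
    have h := sum_weights_mul_pow hw (a := r + E - 1 - i) (b := l) (by lia)
    have hiff : r + E - 1 - (i : ℕ) + l = r + E - 1 ↔ l = i := by
      rw [Fin.ext_iff]; lia
    simp only [hiff] at h
    rw [← h]
    refine Finset.sum_congr rfl fun j _ => ?_
    rw [hexp, zpow_natCast]
    ring
  unfold genSchurFun
  set M : Matrix (Fin (r + E)) (Fin (r + E)) K := Matrix.of fun i j =>
    (if h : (i : ℕ) < r then f ⟨i, h⟩ (z j) else 1) *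
      z j ^ (((r + E : ℕ) : ℤ) - 1 - ((i : ℕ) : ℤ)) with hM
  set V : Matrix (Fin (r + E)) (Fin (r + E)) K := Matrix.of fun i j =>
    z j ^ (((r + E : ℕ) : ℤ) - 1 - ((i : ℕ) : ℤ)) with hV
  set A : Matrix (Fin r) (Fin r) K := Matrix.of fun i l =>
    ∑ j, w j * (f i (z j) * z j ^ (((r + E : ℕ) : ℤ) - 1 - (i : ℕ)) * (z j - 1) ^ (l : ℕ))
    with hA
  have hVW : V.det * W.det = 1 := by
    rw [← Matrix.det_mul, Matrix.det_of_isUpperTriangular]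
    · refine Finset.prod_eq_one fun i _ => ?_
      simpa [Matrix.mul_apply, hV, W] using moment i i le_rfl
    · intro i l hli
      have hli' : l < i := hli
      simpa [Matrix.mul_apply, hV, W, hli'.ne] using moment i l hli'.le
  have hMW : M.det * W.det = A.det := by
    rw [← Matrix.det_mul, ← Matrix.det_submatrix_equiv_self finSumFinEquiv,
      ← Matrix.fromBlocks_toBlocks ((M * W).submatrix finSumFinEquiv finSumFinEquiv)]
    have h21 : ((M * W).submatrix finSumFinEquiv finSumFinEquiv).toBlocks₂₁ = 0 := by
      ext i l
      have hlt : Fin.castAdd E l < Fin.natAdd r i := by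
        rw [Fin.lt_def]; simp; lia
      simpa [Matrix.toBlocks₂₁, Matrix.mul_apply, hM, W, hlt.ne] using moment _ _ hlt.le
    have h11 : ((M * W).submatrix finSumFinEquiv finSumFinEquiv).toBlocks₁₁ = A := by
      ext i l
      simp only [Matrix.toBlocks₁₁, Matrix.mul_apply, hM, W, hA, Matrix.of_apply,
        Matrix.submatrix_apply, finSumFinEquiv_apply_left, Fin.val_castAdd, Fin.is_lt, dif_pos]
      exact Finset.sum_congr rfl fun j _ => by ring
    rw [h21, h11, Matrix.det_fromBlocks_zero₂₁,
      Matrix.det_of_isUpperTriangular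
        (M := ((M * W).submatrix finSumFinEquiv finSumFinEquiv).toBlocks₂₂), Finset.prod_eq_one,
      mul_one]
    · intro i _
      simpa [Matrix.toBlocks₂₂, Matrix.mul_apply, hM, W] using
        moment (Fin.natAdd r i) (Fin.natAdd r i) le_rfl
    · intro i l hli
      have hlt : Fin.natAdd r l < Fin.natAdd r i := by simpa using hli
      simpa [Matrix.toBlocks₂₂, Matrix.mul_apply, hM, W, hlt.ne] using moment _ _ hlt.le
  rw [← hMW, div_eq_iff (left_ne_zero_of_mul_eq_one hVW), mul_assoc, mul_comm W.det, hVW, mul_one]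

end Interpolation

theorem coeff_prod_sum_of_natDegree_le {ι R : Type*} [CommSemiring R] (s : Finset ι)
    (p : ι → R[X]) (ν : ι → ℕ) (h : ∀ i ∈ s, (p i).natDegree ≤ ν i) :
    (∏ i ∈ s, p i).coeff (∑ i ∈ s, ν i) = ∏ i ∈ s, (p i).coeff (ν i) := by
  classical
  induction s using Finset.induction_on with
  | empty => simp
  | insert i s hi ih =>
    have hs : ∀ j ∈ s, (p j).natDegree ≤ ν j := fun j hj => h j (Finset.mem_insert_of_mem hj)
    rw [Finset.prod_insert hi, Finset.sum_insert hi, Finset.prod_insert hi, ← ih hs]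
    exact coeff_mul_add_eq_of_natDegree_le (h i (Finset.mem_insert_self i s))
      ((natDegree_prod_le _ _).trans (Finset.sum_le_sum hs))

theorem coeff_det_sum_of_natDegree_le {n R : Type*} [Fintype n] [DecidableEq n] [CommRing R]
    (M : Matrix n n R[X]) (ν : n → ℕ) (h : ∀ i j, (M i j).natDegree ≤ ν i) :
    M.det.coeff (∑ i, ν i) = (Matrix.of fun i j => (M i j).coeff (ν i)).det := by
  rw [← Matrix.det_transpose, Matrix.det_apply, finsetSum_coeff, ← Matrix.det_transpose,
    Matrix.det_apply]
  refine Finset.sum_congr rfl fun σ _ => ?_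
  rw [coeff_smul]
  congr 1
  exact coeff_prod_sum_of_natDegree_le _ _ _ fun i _ => h i (σ i)

theorem coe_finRotate_pow_apply {r : ℕ} (d : ℕ) (k : Fin r) :
    (((finRotate r ^ d) k : Fin r) : ℕ) = (k + d) % r := by
  induction d with
  | zero => simp [Nat.mod_eq_of_lt k.2]
  | succ d ih =>
    obtain ⟨m, rfl⟩ : ∃ m, r = m + 1 := ⟨r - 1, by have := k.2; lia⟩
    rw [pow_succ', Equiv.Perm.mul_apply, finRotate_apply, Fin.val_add, ih]
    simp [Nat.add_assoc]

theorem sum_add_div_eq {r : ℕ} (hr : 1 ≤ r) (d : ℕ) : ∑ k : Fin r, ((k : ℕ) + d) / r = d := by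
  have h1 : ∑ k : Fin r, (((finRotate r ^ d) k : Fin r) : ℕ) = ∑ k : Fin r, (k : ℕ) :=
    Equiv.sum_comp (finRotate r ^ d) fun k : Fin r => (k : ℕ)
  have h2 : ∑ k : Fin r, ((k : ℕ) + d) =
      r * ∑ k : Fin r, ((k : ℕ) + d) / r + ∑ k : Fin r, ((k : ℕ) + d) % r := by
    rw [Finset.mul_sum, ← Finset.sum_add_distrib]
    exact Finset.sum_congr rfl fun k _ => (Nat.div_add_mod _ _).symm
  simp only [coe_finRotate_pow_apply] at h1
  rw [h1, Finset.sum_add_distrib] at h2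
  simp only [Finset.sum_const, Finset.card_univ, Fintype.card_fin, smul_eq_mul] at h2
  exact (Nat.eq_of_mul_eq_mul_left hr (by lia)).symm

/-- The coefficient of degree `d` of a determinant of polynomials with coefficients
`residueCoeff`: after a cyclic permutation of the rows the leading coefficients form a triangular
matrix. -/
theorem coeff_det_eq_one {r E : ℕ} (hr : 1 ≤ r) (lam : Fin r → ℕ) (d : ℕ)
    (hlow : ∀ i, (lam i : ℤ) - E ≤ d ∨ (r ≤ d ∧ lam i ≤ 2 * E + r))
    (p : Matrix (Fin r) (Fin r) ℚ[X])
    (hp : ∀ i s n, (p i s).coeff n =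
      residueCoeff r E (d + E - lam i) (lam i + (r - 1 - (i : ℕ)) + (s : ℕ)) n) :
    p.det.coeff d = 1 := by
  set σ : Equiv.Perm (Fin r) := finRotate r ^ d with hσ
  set ν : Fin r → ℕ := fun k => ((k : ℕ) + d) / r with hν
  set top : Fin r → ℕ → ℤ := fun k n => (d + E - lam (σ k) : ℤ) + E * n with htop
  have hdecomp : ∀ k : Fin r, r * ν k + ((σ k : Fin r) : ℕ) = k + d := fun k => by
    rw [hσ, coe_finRotate_pow_apply]
    exact Nat.div_add_mod _ _
  have hcoeff : ∀ k s n, (p (σ k) s).coeff n =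
      ((-1) ^ (r - 1)) ^ n * (intChoose (top k n)
        (top k n + (r * (n - ν k : ℤ) + k - s)) : ℤ) := by
    intro k s n
    rw [hp, residueCoeff]
    congr 3
    have h := hdecomp k
    have hlt := (σ k).2
    have hcast : ((lam (σ k) + (r - 1 - ((σ k : Fin r) : ℕ)) + (s : ℕ) : ℕ) : ℤ) =
      lam (σ k) + (r - 1 - ((σ k : Fin r) : ℕ)) + (s : ℕ) := by lia
    rw [hcast]
    zify at h
    simp only [htop]
    linear_combination h
  have htop_pos : ∀ k n, 1 ≤ n → 0 ≤ top k n := by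
    intro k n hn
    have h1 : (E : ℤ) * 1 ≤ E * n := by gcongr; exact_mod_cast hn
    simp only [htop]
    rcases hlow (σ k) with h | ⟨h2, h3⟩ <;> lia
  have htop_ν : ∀ k, 0 ≤ top k (ν k) := by
    intro k
    rcases Nat.eq_zero_or_pos (ν k) with h0 | hpos
    · rcases hlow (σ k) with h | ⟨h2, -⟩
      · simp only [htop, h0]
        push_cast
        lia
      · have : 1 ≤ ν k := (Nat.one_le_div_iff hr).2 (by lia)
        lia
    · exact htop_pos k _ hpos
  have hdeg : ∀ k s, (p (σ k) s).natDegree ≤ ν k := by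
    intro k s
    refine natDegree_le_iff_coeff_eq_zero.2 fun n hn => ?_
    rw [hcoeff, intChoose_eq_zero_of_lt (htop_pos k n (by lia))]
    · simp
    · have h1 : (r : ℤ) * 1 ≤ r * (n - ν k : ℤ) := by gcongr; rw [le_sub_iff_add_le']; exact_mod_cast hn
      have := s.2
      lia
  have hsign : (p.submatrix σ id).det = (-1) ^ ((r - 1) * d) * p.det := by
    rw [Matrix.det_permute, hσ, map_pow, sign_finRotate, ← pow_mul]
    simp
  have hdet : (p.submatrix σ id).det.coeff d = (-1) ^ ((r - 1) * d) := by
    conv_lhs => rw [← sum_add_div_eq hr d]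
    rw [coeff_det_sum_of_natDegree_le (p.submatrix σ id) ν hdeg, Matrix.det_of_isUpperTriangular]
    · have hdiag : ∀ k : Fin r, (p (σ k) k).coeff (ν k) = ((-1) ^ (r - 1)) ^ ν k := fun k => by
        rw [hcoeff]
        simp [intChoose_self (htop_ν k)]
      simp only [Matrix.of_apply, Matrix.submatrix_apply, id]
      rw [Finset.prod_congr rfl fun k _ => hdiag k, Finset.prod_pow_eq_pow_sum,
        sum_add_div_eq hr d, pow_mul]
    · intro k s hsk
      have hsk' : (s : ℕ) < k := hsk
      simp only [Matrix.of_apply, Matrix.submatrix_apply, id]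
      rw [hcoeff, intChoose_eq_zero_of_lt (htop_ν k)]
      · simp
      · rw [sub_self]; lia
  have hsq : ((-1 : ℚ[X]) ^ ((r - 1) * d)) = C ((-1) ^ ((r - 1) * d)) := by simp
  rw [hsign, hsq, coeff_C_mul] at hdet
  exact mul_left_cancel₀ (pow_ne_zero _ (by norm_num)) (hdet.trans (mul_one _).symm)

/-- Roots setup: `∏ (X - z_i) = (X-1)^N + (-1)^r τ X^{N-r}` with `τ`
transcendental over `ℚ`. For a partition `λ` with `r` parts, `d ≥ 0` and
`f_i(z) = z^d (1 - z⁻¹)^{λ_i + r - i}`, if either `d ≥ λ_1 - (N-r)`, or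
(`r < N`, `d ≥ r` and `λ_1 ≤ 2(N-r)+r`), then every `F ∈ ℚ[T]` with
`F(τ) = s_{(f_1,…,f_r)}(z)` has coefficient of `T^d` equal to `1`. -/
theorem stmt7 {K : Type*} [Field K] [CharZero K] (N r : ℕ) (hr : 1 ≤ r) (hrN : r ≤ N)
    (τ : K) (hτ : Transcendental ℚ τ)
    (z : Fin N → K) (hz : Function.Injective z)
    (hroots : ∏ i, (Polynomial.X - Polynomial.C (z i)) =
      (Polynomial.X - Polynomial.C (1 : K)) ^ N +
        Polynomial.C ((-1 : K) ^ r * τ) * Polynomial.X ^ (N - r))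
    (lam : Fin r → ℕ) (hlam : Antitone lam) (d : ℕ)
    (hcond : ((lam ⟨0, hr⟩ : ℤ) - ((N : ℤ) - (r : ℤ)) ≤ (d : ℤ)) ∨
      (r < N ∧ r ≤ d ∧ lam ⟨0, hr⟩ ≤ 2 * (N - r) + r)) :
    ∀ F : Polynomial ℚ,
      Polynomial.aeval τ F =
        genSchurFun N r (fun i w => w ^ d * (1 - w⁻¹) ^ (lam i + (r - 1 - (i : ℕ)))) z →
      F.coeff d = 1 := by
  obtain ⟨E, rfl⟩ : ∃ E, N = r + E := ⟨N - r, by lia⟩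
  rw [Nat.add_sub_cancel_left] at hroots hcond
  intro F hF
  have hz0 : ∀ j, z j ≠ 0 := by
    intro j hj
    have h := congrArg (eval 0) hroots
    rw [eval_prod, Finset.prod_eq_zero (Finset.mem_univ j) (by simp [hj])] at h
    rcases Nat.eq_zero_or_pos E with rfl | hE
    · have h1 : (-1 : K) ^ r * (1 + τ) = 0 := by
        simp at h
        linear_combination -h
      have h2 := (mul_eq_zero.1 h1).resolve_left (pow_ne_zero _ (by norm_num))
      have h3 : aeval τ (1 + X : ℚ[X]) = 0 := by simpa using h2
      have h4 := (transcendental_iff.1 hτ) _ h3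
      have h5 := congrArg (eval 0) h4
      simp at h5
    · simp only [eval_add, eval_mul, eval_pow, eval_sub, eval_X, eval_C, zero_pow hE.ne', mul_zero,
        add_zero, zero_sub] at h
      exact pow_ne_zero _ (by norm_num) h.symm
  have hroot : ∀ j, (z j - 1) ^ (r + E) = (-1) ^ (r - 1) * τ * z j ^ E := by
    intro j
    have h := congrArg (eval (z j)) hroots
    rw [eval_prod, Finset.prod_eq_zero (Finset.mem_univ j) (by simp)] at h
    simp only [eval_add, eval_pow, eval_sub, eval_X, eval_C, eval_mul] at h
    obtain ⟨m, rfl⟩ : ∃ m, r = m + 1 := ⟨r - 1, by lia⟩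
    rw [Nat.add_sub_cancel]
    linear_combination -h
  obtain ⟨w, hw⟩ := exists_weights_sum_eval_eq_coeff (by lia) hz
  set x : ℤ → ℕ → K := fun a b => ∑ j, w j * (z j ^ a * (z j - 1) ^ b) with hx
  have hlam0 : ∀ i, lam i ≤ lam ⟨0, hr⟩ := fun i => hlam (Nat.zero_le _)
  have hpoly : ∀ a b, (0 ≤ a ∨ 1 ≤ E) →
      ∃ p : ℚ[X], aeval τ p = x a b ∧ ∀ n, p.coeff n = residueCoeff r E a b n := by
    refine fun a b => exists_polynomial_coeff_eq_residueCoeff hr τ x ?_ ?_ ?_ a b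
    · intro a b
      simp only [hx]
      rw [← Finset.sum_add_distrib]
      refine Finset.sum_congr rfl fun j _ => ?_
      rw [zpow_add_one₀ (hz0 j)]
      ring
    · intro a b
      simp only [hx]
      rw [Finset.mul_sum]
      refine Finset.sum_congr rfl fun j _ => ?_
      rw [pow_add, hroot, zpow_add₀ (hz0 j), zpow_natCast]
      ring
    · intro b hb
      simpa [hx] using sum_weights_mul_pow hw (a := 0) (b := b) (by lia)
  have hentry : ∀ i s : Fin r, ∃ p : ℚ[X],
      aeval τ p = x (d + E - lam i) (lam i + (r - 1 - (i : ℕ)) + s) ∧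
      ∀ n, p.coeff n =
        residueCoeff r E (d + E - lam i) (lam i + (r - 1 - (i : ℕ)) + (s : ℕ)) n := by
    refine fun i s => hpoly _ _ ?_
    have := hlam0 i
    rcases hcond with h | ⟨h, -⟩
    · left; lia
    · right; lia
  choose p hpτ hpc using hentry
  have hdet : aeval τ (Matrix.det (Matrix.of p)) = aeval τ F := by
    rw [hF, genSchurFun_eq_det _ hw, AlgHom.map_det]
    congr 1
    ext i s
    simp only [AlgHom.mapMatrix_apply, Matrix.map_apply, Matrix.of_apply, hpτ, hx]
    refine Finset.sum_congr rfl fun j _ => ?_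
    have hone : 1 - (z j)⁻¹ = (z j)⁻¹ * (z j - 1) := by
      rw [mul_sub, inv_mul_cancel₀ (hz0 j), mul_one]
    have hexp : (d + E - lam i : ℤ) = d + -((lam i + (r - 1 - (i : ℕ)) : ℕ) : ℤ) +
        (((r + E : ℕ) : ℤ) - 1 - (i : ℕ)) := by
      have := i.2
      lia
    rw [hone, mul_pow, hexp, zpow_add₀ (hz0 j), zpow_add₀ (hz0 j), zpow_neg, zpow_natCast,
      zpow_natCast, inv_pow, pow_add (z j - 1)]
    ring
  rw [← transcendental_iff_injective.1 hτ hdet]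
  refine coeff_det_eq_one (E := E) hr lam d (fun i => ?_) _ hpc
  have := hlam0 i
  rcases hcond with h | ⟨-, h, h'⟩
  · left; push_cast at h; lia
  · right; exact ⟨h, by lia⟩
end

section
/- Assume the rank-2 roots setup. Let λ = (λ_1 ≥ λ_2 ≥ 0) be a partition with λ_1 ≤ 3k. For an integer d ≥ 0, set f_1(z) = z^{d−1} (1 − z^{-1})^{λ_1 + 1} and f_2(z) = z^{d−1} (1 − z^{-1})^{λ_2}, and let c_d denote the coefficient of T^d in any polynomial F ∈ ℚ[T] with F(τ) = s_{(f_1,f_2)}(z_1,…,z_N). Then: c_0 = 1 if λ = (k,k) and c_0 = 0 otherwise; c_1 = 1 if λ_1 = 2k+1 and λ_2 ≤ k+1, c_1 = −1 if λ_1 = 2k+2 and λ_2 ≤ k, and c_1 = 0 otherwise; c_2 = 1 if λ = (2k+2, 2k+2) and c_2 = 0 otherwise; and c_d = 0 for all d ≥ 3. -/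
/-- `s_{(f_1,f_2)}(z_1,…,z_N)` for `f_1(z) = z^{d-1} (1-z⁻¹)^{λ_1+1}`,
`f_2(z) = z^{d-1} (1-z⁻¹)^{λ_2}` (the exponent `d-1` is an integer). -/
noncomputable def svalRank2Det {K : Type*} [Field K] (N : ℕ) (z : Fin N → K)
    (lam1 lam2 d : ℕ) : K :=
  genSchurFun N 2
    ![fun w => w ^ ((d : ℤ) - 1) * (1 - w⁻¹) ^ (lam1 + 1),
      fun w => w ^ ((d : ℤ) - 1) * (1 - w⁻¹) ^ lam2] z

/-- The binomial coefficient `M choose r` for integers `M`, `r`, zero when `r < 0`. -/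
def binomInt (M r : ℤ) : ℤ := if r < 0 then 0 else Ring.choose M r.toNat

lemma binomInt_of_neg {M r : ℤ} (h : r < 0) : binomInt M r = 0 := by
  simp [binomInt, h]

lemma binomInt_natCast (M : ℤ) (n : ℕ) : binomInt M n = Ring.choose M n := by
  simp [binomInt]

lemma binomInt_zero_right (M : ℤ) : binomInt M 0 = 1 := by
  simp [binomInt]

lemma binomInt_add_one (M r : ℤ) :
    binomInt (M + 1) r = binomInt M r + binomInt M (r - 1) := by
  rcases lt_or_ge r 0 with h | h
  · rw [binomInt_of_neg h, binomInt_of_neg h, binomInt_of_neg (by omega), add_zero]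
  · lift r to ℕ using h
    cases r with
    | zero => simp [binomInt]
    | succ n =>
      rw [show ((n + 1 : ℕ) : ℤ) - 1 = (n : ℕ) by push_cast; ring]
      simp only [binomInt_natCast]
      rw [Ring.choose_succ_succ, add_comm]

lemma binomInt_eq_zero_of_lt {M r : ℤ} (h₀ : 0 ≤ M) (h : M < r) : binomInt M r = 0 := by
  lift r to ℕ using by omega
  lift M to ℕ using h₀
  rw [binomInt_natCast, Ring.choose_natCast, Nat.choose_eq_zero_of_lt (by omega), Nat.cast_zero]

lemma binomInt_self {M r : ℤ} (h : M = r) : binomInt M r = if 0 ≤ r then 1 else 0 := by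
  subst h
  split_ifs with h
  · lift M to ℕ using h
    rw [binomInt_natCast, Ring.choose_natCast, Nat.choose_self, Nat.cast_one]
  · exact binomInt_of_neg (by omega)

lemma binomInt_sub_one {M r : ℤ} (h : M = r - 1) :
    binomInt M r = if r = 0 then 1 else 0 := by
  have := binomInt_add_one M r
  rw [binomInt_self (show M + 1 = r by omega), binomInt_self (show M = r - 1 by omega)] at this
  grind

lemma binomInt_sub_two {M r : ℤ} (h : M = r - 2) :
    binomInt M r = if r = 0 then 1 else if r = 1 then -1 else 0 := by
  have := binomInt_add_one M r
  rw [binomInt_sub_one (show M + 1 = r - 1 by omega),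
    binomInt_sub_one (show M = r - 1 - 1 by omega)] at this
  grind

/-- The polynomial in `T` whose `T^j`-coefficient is
`(-1)^j * ((m + k j) choose ((k + 2) (j + 1) - n - 1))`. -/
noncomputable def residuePoly (k : ℕ) (m : ℤ) (n : ℕ) : Polynomial ℚ :=
  ∑ j ∈ Finset.range (m.natAbs + n + 1), Polynomial.monomial j
    (((-1) ^ j * binomInt (m + k * j) ((k + 2) * (j + 1) - n - 1) : ℤ) : ℚ)

lemma residuePoly_coeff {k : ℕ} (hk : 1 ≤ k) (m : ℤ) (n j : ℕ) :
    (residuePoly k m n).coeff j =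
      (((-1) ^ j * binomInt (m + k * j) ((k + 2) * (j + 1) - n - 1) : ℤ) : ℚ) := by
  rw [residuePoly, Polynomial.finsetSum_coeff]
  simp only [Polynomial.coeff_monomial, Finset.sum_ite_eq', Finset.mem_range]
  split_ifs with h
  · rfl
  · have h₁ : (j : ℤ) ≤ k * j := by nlinarith
    rw [binomInt_eq_zero_of_lt (by omega) (by ring_nf at h₁ ⊢; omega)]
    simp

lemma residuePoly_add_one {k : ℕ} (hk : 1 ≤ k) (m : ℤ) (n : ℕ) :
    residuePoly k (m + 1) n = residuePoly k m n + residuePoly k m (n + 1) := by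
  ext j
  rw [Polynomial.coeff_add]
  simp only [residuePoly_coeff hk]
  rw [show m + 1 + k * j = m + k * j + 1 by ring, binomInt_add_one]
  push_cast
  rw [sub_sub _ (n : ℤ) 1]
  ring

lemma residuePoly_add_nat {k : ℕ} (hk : 1 ≤ k) (m : ℤ) (n : ℕ) :
    residuePoly k m (n + (k + 2)) = -(Polynomial.X * residuePoly k (m + k) n) := by
  ext j
  rw [Polynomial.coeff_neg]
  cases j with
  | zero =>
    rw [Polynomial.coeff_X_mul_zero, residuePoly_coeff hk, binomInt_of_neg (by push_cast; omega)]
    simp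
  | succ j =>
    rw [Polynomial.coeff_X_mul, residuePoly_coeff hk, residuePoly_coeff hk,
      show m + k * ((j + 1 : ℕ) : ℤ) = m + k + k * j by push_cast; ring,
      show ((k : ℤ) + 2) * (((j + 1 : ℕ) : ℤ) + 1) - ((n + (k + 2) : ℕ) : ℤ) - 1 =
        (k + 2) * (j + 1) - n - 1 by push_cast; ring]
    push_cast
    ring

lemma residuePoly_zero {k : ℕ} (hk : 1 ≤ k) {n : ℕ} (hn : n < k + 2) :
    residuePoly k 0 n = if n = k + 1 then 1 else 0 := by
  ext j
  rw [residuePoly_coeff hk]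
  cases j with
  | zero =>
    split_ifs with h
    · subst h
      rw [binomInt_self (by push_cast; ring)]
      simp
    · rw [binomInt_eq_zero_of_lt (by simp) (by push_cast; omega)]
      simp
  | succ j =>
    have h₁ : (0 : ℤ) ≤ k * j := by positivity
    rw [binomInt_eq_zero_of_lt (by positivity) (by push_cast; ring_nf at h₁ ⊢; omega)]
    split_ifs
    · simp [Polynomial.coeff_one]
    · simp

/-- A two-parameter family obeying the relations of `z^m (z-1)^n` modulo
`(z-1)^(k+2) + τ z^k` vanishes once it vanishes at `m = 0`, `n < k + 2`. -/
lemma eq_zero_of_recurrence {K : Type*} [Field K] {k : ℕ} (hk : 1 ≤ k) (τ : K)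
    (D : ℤ → ℕ → K) (hD : ∀ m n, D (m + 1) n = D m n + D m (n + 1))
    (hτ : ∀ m n, D m (n + (k + 2)) = -(τ * D (m + k) n))
    (h₀ : ∀ n < k + 2, D 0 n = 0) (m : ℤ) (n : ℕ) : D m n = 0 := by
  have shift : ∀ (a : ℕ) (m : ℤ) (n : ℕ), (∀ i ≤ a, D m (n + i) = 0) → D (m + a) n = 0 := by
    intro a
    induction a with
    | zero => intro m n h; simpa using h 0 le_rfl
    | succ a ih =>
      intro m n h
      rw [show m + ((a + 1 : ℕ) : ℤ) = m + 1 + a by push_cast; ring]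
      refine ih _ _ fun i hi => ?_
      rw [hD, h i (by omega), add_assoc, h (i + 1) (by omega), add_zero]
  have zero : ∀ n, D 0 n = 0 := by
    intro n
    induction n using Nat.strong_induction_on with
    | _ n ih =>
      rcases lt_or_ge n (k + 2) with h | h
      · exact h₀ n h
      · obtain ⟨t, rfl⟩ := Nat.exists_eq_add_of_le' h
        rw [hτ, shift k 0 t fun i hi => ih _ (by omega), mul_zero, neg_zero]
  have nonneg : ∀ (a : ℕ) n, D a n = 0 := fun a n => by
    simpa using shift a 0 n fun i _ => zero _
  have down : ∀ (a : ℕ) (m : ℤ), -(a : ℤ) ≤ m → ∀ n, D m n = 0 := by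
    intro a
    induction a with
    | zero =>
      intro m hm n
      lift m to ℕ using by simpa using hm
      exact nonneg m n
    | succ a ih =>
      intro m hm n
      rcases le_or_gt (-(a : ℤ)) m with h | h
      · exact ih m h n
      · have step : ∀ n, D m (n + 1) = 0 → D m n = 0 := fun n hn => by
          have := hD m n
          rw [ih (m + 1) (by omega), hn, add_zero] at this
          exact this.symm
        have back : ∀ t n, D m (n + t) = 0 → D m n = 0 := by
          intro t
          induction t with
          | zero => intro n h; exact h
          | succ t iht => intro n h; exact iht n (step _ h)
        refine back (k + 2) n ?_
        rw [hτ, ih _ (by push_cast at hm; omega), mul_zero, neg_zero]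
  exact down m.natAbs m (by omega) n

section Coefficients

variable {K : Type*} [Field K] {N : ℕ}

/-- The matrix of the values of the monomials `1, …, X^(N-1)` at the points `z_j`, in order of
decreasing degree. -/
noncomputable def monomialMatrix (z : Fin N → K) : Matrix (Fin N) (Fin N) K :=
  Matrix.of fun i j => z j ^ (N - 1 - (i : ℕ))

lemma monomialMatrix_det_ne_zero {z : Fin N → K} (hz : Function.Injective z) :
    (monomialMatrix z).det ≠ 0 := by
  have h : monomialMatrix z =
      ((Matrix.vandermonde z).submatrix id (Fin.revPerm : Equiv.Perm (Fin N))).transpose := by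
    ext i j
    simp only [monomialMatrix, Matrix.of_apply, Matrix.transpose_apply, Matrix.submatrix_apply,
      Matrix.vandermonde_apply, id, Fin.revPerm_apply, Fin.val_rev]
    congr 1
    omega
  rw [h, Matrix.det_transpose, Matrix.det_permute']
  refine mul_ne_zero ?_ (Matrix.det_vandermonde_ne_zero_iff.2 hz)
  rcases Int.units_eq_one_or (Equiv.Perm.sign (Fin.revPerm : Equiv.Perm (Fin N))) with h | h <;>
    simp [h]

/-- The coefficients, in decreasing degree, of the polynomial of degree less than `N` taking the
values `g` at the points `z`. -/
noncomputable def interpCoeff (z g : Fin N → K) : Fin N → K :=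
  Matrix.vecMul g (monomialMatrix z)⁻¹

lemma interpCoeff_vecMul {z : Fin N → K} (hz : Function.Injective z) (g : Fin N → K) :
    Matrix.vecMul (interpCoeff z g) (monomialMatrix z) = g := by
  rw [interpCoeff, Matrix.vecMul_vecMul,
    Matrix.nonsing_inv_mul _ (monomialMatrix_det_ne_zero hz).isUnit, Matrix.vecMul_one]

lemma interpCoeff_of_vecMul {z : Fin N → K} (hz : Function.Injective z) (a : Fin N → K) :
    interpCoeff z (Matrix.vecMul a (monomialMatrix z)) = a := by
  rw [interpCoeff, Matrix.vecMul_vecMul,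
    Matrix.mul_nonsing_inv _ (monomialMatrix_det_ne_zero hz).isUnit, Matrix.vecMul_one]

lemma interpCoeff_eval {z : Fin N → K} (hz : Function.Injective z) (Q : Polynomial K)
    (hQ : Q.natDegree < N) (i : Fin N) :
    interpCoeff z (fun j => Q.eval (z j)) i = Q.coeff (N - 1 - i) := by
  have h : (fun j => Q.eval (z j)) =
      Matrix.vecMul (fun i : Fin N => Q.coeff (N - 1 - i)) (monomialMatrix z) := by
    ext j
    rw [Polynomial.eval_eq_sum_range' hQ, ← Finset.sum_range_reflect, Finset.sum_range]
    rfl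
  rw [h, interpCoeff_of_vecMul hz]

lemma interpCoeff_add (z g h : Fin N → K) :
    interpCoeff z (g + h) = interpCoeff z g + interpCoeff z h :=
  Matrix.add_vecMul _ _ _

lemma interpCoeff_smul (z g : Fin N → K) (c : K) :
    interpCoeff z (c • g) = c • interpCoeff z g :=
  Matrix.smul_vecMul _ _ _

lemma interpCoeff_sum {ι : Type*} (s : Finset ι) (z : Fin N → K) (g : ι → Fin N → K) :
    interpCoeff z (∑ i ∈ s, g i) = ∑ i ∈ s, interpCoeff z (g i) :=
  map_sum (Matrix.vecMulLinear (monomialMatrix z)⁻¹ : (Fin N → K) →ₗ[K] (Fin N → K)) _ _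

end Coefficients

section RankTwo

variable {K : Type*} [Field K] {k : ℕ}

/-- Multiplying the interpolated values by `z` shifts the leading coefficients. -/
lemma interpCoeff_mul_self {z : Fin (k + 2) → K} (hz : Function.Injective z)
    (g : Fin (k + 2) → K) :
    interpCoeff z (z * g) 0 =
      interpCoeff z g 1 + interpCoeff z g 0 * interpCoeff z (fun j => z j ^ (k + 2)) 0 := by
  have h : z * g = interpCoeff z g 0 • (fun j => z j ^ (k + 2)) +
      ∑ i : Fin (k + 1), interpCoeff z g i.succ •
        (fun j => ((Polynomial.X : Polynomial K) ^ (k + 1 - (i : ℕ))).eval (z j)) := by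
    ext j
    have hg := congrFun (interpCoeff_vecMul hz g) j
    rw [Pi.mul_apply, ← hg]
    simp only [Matrix.vecMul, dotProduct, Fin.sum_univ_succ (n := k + 1), Pi.add_apply,
      Pi.smul_apply, smul_eq_mul, Finset.sum_apply, mul_add, Finset.mul_sum, monomialMatrix,
      Matrix.of_apply, Polynomial.eval_pow, Polynomial.eval_X]
    congr 1
    · simp only [Fin.val_zero]
      rw [show k + 2 - 1 - 0 = k + 1 by omega]
      ring
    · refine Finset.sum_congr rfl fun i _ => ?_
      rw [Fin.val_succ, show k + 1 - (i : ℕ) = (k + 2 - 1 - (i + 1)) + 1 by omega, pow_succ]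
      ring
  conv_lhs => rw [h]
  rw [interpCoeff_add, interpCoeff_sum, interpCoeff_smul, add_comm]
  simp only [interpCoeff_smul, Pi.add_apply, Finset.sum_apply, Pi.smul_apply, smul_eq_mul]
  congr 1
  rw [Fin.sum_univ_succ, Finset.sum_eq_zero, add_zero]
  · rw [interpCoeff_eval hz _ (by simp)]
    simp [Polynomial.coeff_X_pow]
  · intro i _
    rw [interpCoeff_eval hz _ (by rw [Polynomial.natDegree_X_pow]; omega), Polynomial.coeff_X_pow,
      if_neg (by simp; omega), mul_zero]

lemma genSchurFun_two {z : Fin (k + 2) → K} (hz : Function.Injective z) (f : Fin 2 → K → K)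
    (g₁ g₂ : Fin (k + 2) → K)
    (h₁ : ∀ j, g₁ j = f 0 (z j) * z j ^ (k + 1)) (h₂ : ∀ j, g₂ j = f 1 (z j) * z j ^ k) :
    genSchurFun (k + 2) 2 f z =
      interpCoeff z g₁ 0 * interpCoeff z (z * g₂) 0 -
        interpCoeff z (z * g₁) 0 * interpCoeff z g₂ 0 := by
  have hV : (Matrix.of fun i j : Fin (k + 2) =>
      z j ^ (((k + 2 : ℕ) : ℤ) - 1 - ((i : ℕ) : ℤ))) = monomialMatrix z := by
    ext i j
    rw [Matrix.of_apply, monomialMatrix, Matrix.of_apply, ← zpow_natCast]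
    congr 1
    omega
  let A : Matrix (Fin 2 ⊕ Fin k) (Fin 2 ⊕ Fin k) K :=
    Matrix.fromBlocks
      (Matrix.of fun i j => interpCoeff z (![g₁, g₂] i) (Fin.cast (add_comm 2 k) (Fin.castAdd k j)))
      (Matrix.of fun i j => interpCoeff z (![g₁, g₂] i) (Fin.cast (add_comm 2 k) (Fin.natAdd 2 j)))
      0 1
  let e : Fin 2 ⊕ Fin k ≃ Fin (k + 2) := finSumFinEquiv.trans (finCongr (add_comm 2 k))
  have hM : (Matrix.of fun i j : Fin (k + 2) =>
      (if h : (i : ℕ) < 2 then f ⟨i, h⟩ (z j) else 1) *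
        z j ^ (((k + 2 : ℕ) : ℤ) - 1 - ((i : ℕ) : ℤ))) =
      Matrix.reindex e e A * monomialMatrix z := by
    ext i j
    obtain ⟨i, rfl⟩ := e.surjective i
    have hmul : (Matrix.reindex e e A * monomialMatrix z) (e i) j =
        ∑ l, A i l * monomialMatrix z (e l) j := by
      rw [Matrix.mul_apply, ← e.sum_comp]
      simp
    rw [hmul, Matrix.of_apply]
    rcases i with i | i
    · have hrow : ∑ l, A (Sum.inl i) l * monomialMatrix z (e l) j = (![g₁, g₂] i) j := by
        conv_rhs => rw [← interpCoeff_vecMul hz (![g₁, g₂] i)]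
        simp only [Matrix.vecMul, dotProduct]
        rw [← e.sum_comp]
        refine Finset.sum_congr rfl fun l _ => ?_
        rcases l with l | l <;> rfl
      rw [hrow]
      fin_cases i
      · have hv : ((e (Sum.inl 0) : Fin (k + 2)) : ℕ) = 0 := rfl
        simp only [Fin.zero_eta, hv]
        simp [h₁, ← zpow_natCast]
        left
        congr 1
        omega
      · have hv : ((e (Sum.inl 1) : Fin (k + 2)) : ℕ) = 1 := rfl
        simp only [Fin.mk_one, hv]
        simp [h₂, ← zpow_natCast]
        left
        congr 1
        omega
    · have hv : ((e (Sum.inr i) : Fin (k + 2)) : ℕ) = 2 + i := rfl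
      rw [dif_neg (by omega), one_mul,
        show z j ^ (((k + 2 : ℕ) : ℤ) - 1 - ((e (Sum.inr i) : ℕ) : ℤ)) =
          monomialMatrix z (e (Sum.inr i)) j from congrFun (congrFun hV _) j]
      simp [A, Matrix.one_apply]
  rw [genSchurFun, hM, hV, Matrix.det_mul,
    mul_div_cancel_right₀ _ (monomialMatrix_det_ne_zero hz), Matrix.det_reindex_self,
    Matrix.det_fromBlocks_zero₂₁, Matrix.det_one, mul_one, Matrix.det_fin_two,
    interpCoeff_mul_self hz, interpCoeff_mul_self hz]
  have c₀ : Fin.cast (add_comm 2 k) (Fin.castAdd k 0) = 0 := rfl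
  have c₁ : Fin.cast (add_comm 2 k) (Fin.castAdd k 1) = 1 := by ext; simp
  simp only [Matrix.of_apply, c₀, c₁, Matrix.cons_val_zero, Matrix.cons_val_one]
  ring

/-- The leading interpolation coefficient of `z^m (z-1)^n` is the value at `τ` of
`residuePoly`. -/
lemma interpCoeff_eq_aeval [CharZero K] (hk : 1 ≤ k) {τ : K} {z : Fin (k + 2) → K}
    (hz : Function.Injective z) (hne : ∀ j, z j ≠ 0)
    (hroot : ∀ j, (z j - 1) ^ (k + 2) = -(τ * z j ^ k)) (m : ℤ) (n : ℕ) :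
    interpCoeff z (fun j => z j ^ m * (z j - 1) ^ n) 0 =
      Polynomial.aeval τ (residuePoly k m n) := by
  rw [← sub_eq_zero]
  refine eq_zero_of_recurrence hk τ (fun m n => interpCoeff z (fun j => z j ^ m * (z j - 1) ^ n) 0 -
      Polynomial.aeval τ (residuePoly k m n)) ?_ ?_ ?_ m n
  · intro m n
    have h : (fun j => z j ^ (m + 1) * (z j - 1) ^ n) =
        (fun j => z j ^ m * (z j - 1) ^ n) + (fun j => z j ^ m * (z j - 1) ^ (n + 1)) := by
      ext j
      rw [Pi.add_apply, zpow_add_one₀ (hne j)]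
      ring
    simp only [h, interpCoeff_add, residuePoly_add_one hk, map_add, Pi.add_apply]
    ring
  · intro m n
    have h : (fun j => z j ^ m * (z j - 1) ^ (n + (k + 2))) =
        (-τ) • (fun j => z j ^ (m + k) * (z j - 1) ^ n) := by
      ext j
      rw [Pi.smul_apply, zpow_add₀ (hne j), pow_add, hroot, zpow_natCast, smul_eq_mul]
      ring
    simp only [h, interpCoeff_smul, residuePoly_add_nat hk, map_neg, map_mul, Polynomial.aeval_X,
      Pi.smul_apply, smul_eq_mul]
    ring
  · intro n hn
    have h := interpCoeff_eval hz ((Polynomial.X - Polynomial.C 1) ^ n)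
      (by rw [Polynomial.natDegree_pow, Polynomial.natDegree_X_sub_C]; omega) 0
    simp only [Polynomial.eval_pow, Polynomial.eval_sub, Polynomial.eval_X, Polynomial.eval_C] at h
    simp only [zpow_zero, one_mul, h, residuePoly_zero hk hn]
    have hdeg : ((Polynomial.X - Polynomial.C (1 : K)) ^ n).natDegree = n := by
      rw [Polynomial.natDegree_pow, Polynomial.natDegree_X_sub_C, mul_one]
    have hmon : ((Polynomial.X - Polynomial.C (1 : K)) ^ n).Monic :=
      (Polynomial.monic_X_sub_C 1).pow n
    split_ifs with hnk
    · have := hmon.coeff_natDegree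
      rw [hdeg] at this
      subst hnk
      simpa [sub_eq_zero] using this
    · rw [Polynomial.coeff_eq_zero_of_natDegree_lt (by rw [hdeg]; simp; omega)]
      simp

lemma svalRank2Det_eq_aeval [CharZero K] (hk : 1 ≤ k) {τ : K} {z : Fin (k + 2) → K}
    (hz : Function.Injective z) (hne : ∀ j, z j ≠ 0)
    (hroot : ∀ j, (z j - 1) ^ (k + 2) = -(τ * z j ^ k)) (lam1 lam2 d : ℕ) :
    svalRank2Det (k + 2) z lam1 lam2 d = Polynomial.aeval τ
      (residuePoly k (d + k - lam1 - 1) (lam1 + 1) * residuePoly k (d + k - lam2) lam2 -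
        residuePoly k (d + k - lam1) (lam1 + 1) * residuePoly k (d + k - lam2 - 1) lam2) := by
  have shift : ∀ (m : ℤ) (n : ℕ), z * (fun j => z j ^ (m - 1) * (z j - 1) ^ n) =
      fun j => z j ^ m * (z j - 1) ^ n := fun m n => by
    ext j
    rw [Pi.mul_apply, ← mul_assoc, mul_comm (z j), zpow_sub_one₀ (hne j),
      inv_mul_cancel_right₀ (hne j)]
  have key : ∀ (j : Fin (k + 2)) (n c : ℕ), z j ^ ((d : ℤ) + c - n - 1) * (z j - 1) ^ n =
      z j ^ ((d : ℤ) - 1) * (1 - (z j)⁻¹) ^ n * z j ^ c := fun j n c => by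
    have hw : 1 - (z j)⁻¹ = (z j - 1) * (z j)⁻¹ := by
      rw [sub_mul, mul_inv_cancel₀ (hne j), one_mul]
    rw [hw, mul_pow, inv_pow, ← zpow_natCast (z j) n, ← zpow_natCast (z j) c, ← zpow_neg,
      show (d : ℤ) + c - n - 1 = (d - 1) + (-n) + c by ring, zpow_add₀ (hne j), zpow_add₀ (hne j)]
    ring
  rw [svalRank2Det, genSchurFun_two hz _ (fun j => z j ^ ((d : ℤ) + k - lam1 - 1) *
    (z j - 1) ^ (lam1 + 1)) (fun j => z j ^ ((d : ℤ) + k - lam2 - 1) * (z j - 1) ^ lam2)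
    (fun j => ?_) (fun j => ?_), shift, shift]
  · simp only [interpCoeff_eq_aeval hk hz hne hroot, map_sub, map_mul]
  · refine Eq.trans ?_ (key j (lam1 + 1) (k + 1))
    congr 2
    push_cast
    ring
  · exact key j lam2 k

end RankTwo

lemma residuePoly_mul_coeff {k : ℕ} (hk : 1 ≤ k) (m₁ m₂ : ℤ) (n₁ n₂ d : ℕ) :
    (residuePoly k m₁ n₁ * residuePoly k m₂ n₂).coeff d =
      (((-1) ^ d * ∑ p ∈ Finset.HasAntidiagonal.antidiagonal d,
        binomInt (m₁ + k * p.1) ((k + 2) * (p.1 + 1) - n₁ - 1) *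
          binomInt (m₂ + k * p.2) ((k + 2) * (p.2 + 1) - n₂ - 1) : ℤ) : ℚ) := by
  rw [Polynomial.coeff_mul, Finset.mul_sum, Int.cast_sum]
  refine Finset.sum_congr rfl fun p hp => ?_
  rw [residuePoly_coeff hk, residuePoly_coeff hk, ← Finset.HasAntidiagonal.mem_antidiagonal.1 hp, pow_add]
  push_cast
  ring

/-- Rank-2 roots setup (`k = N-2`,
`∏(X - z_i) = (X-1)^N + τ X^{N-2}`, `τ` transcendental over `ℚ`). For a partition
`λ = (λ_1 ≥ λ_2 ≥ 0)` with `λ_1 ≤ 3k`, the coefficients `c_d` of the determinant-twisted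
invariants satisfy: `c_0 = 1` iff `λ = (k,k)` (else `0`); `c_1 = 1` if `λ_1 = 2k+1` and
`λ_2 ≤ k+1`, `c_1 = -1` if `λ_1 = 2k+2` and `λ_2 ≤ k`, else `c_1 = 0`; `c_2 = 1` iff
`λ = (2k+2, 2k+2)` (else `0`); and `c_d = 0` for `d ≥ 3`. -/
theorem stmt12 {K : Type*} [Field K] [CharZero K] (N : ℕ) (hN : 3 ≤ N)
    (k : ℕ) (hk : k = N - 2)
    (τ : K) (hτ : Transcendental ℚ τ)
    (z : Fin N → K) (hz : Function.Injective z)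
    (hroots : ∏ i, (Polynomial.X - Polynomial.C (z i)) =
      (Polynomial.X - Polynomial.C (1 : K)) ^ N + Polynomial.C τ * Polynomial.X ^ (N - 2))
    (lam1 lam2 : ℕ) (hlam : lam2 ≤ lam1) (hup : lam1 ≤ 3 * k) :
    (∀ F : Polynomial ℚ,
      Polynomial.aeval τ F = svalRank2Det N z lam1 lam2 0 →
        F.coeff 0 = if lam1 = k ∧ lam2 = k then 1 else 0) ∧
    (∀ F : Polynomial ℚ,
      Polynomial.aeval τ F = svalRank2Det N z lam1 lam2 1 →
        F.coeff 1 =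
          if lam1 = 2 * k + 1 ∧ lam2 ≤ k + 1 then 1
          else if lam1 = 2 * k + 2 ∧ lam2 ≤ k then -1
          else 0) ∧
    (∀ F : Polynomial ℚ,
      Polynomial.aeval τ F = svalRank2Det N z lam1 lam2 2 →
        F.coeff 2 = if lam1 = 2 * k + 2 ∧ lam2 = 2 * k + 2 then 1 else 0) ∧
    (∀ d : ℕ, 3 ≤ d → ∀ F : Polynomial ℚ,
      Polynomial.aeval τ F = svalRank2Det N z lam1 lam2 d → F.coeff d = 0) := by
  obtain rfl : N = k + 2 := by omega
  have hk₁ : 1 ≤ k := by omega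
  have hne : ∀ j, z j ≠ 0 := by
    intro j hj
    have h := congrArg (Polynomial.eval 0) hroots
    rw [Polynomial.eval_prod, Finset.prod_eq_zero (Finset.mem_univ j) (by simp [hj])] at h
    have h0 : k ≠ 0 := by omega
    simp [h0] at h
    exact pow_ne_zero (k + 2) (neg_ne_zero.2 one_ne_zero) h.symm
  have hroot : ∀ j, (z j - 1) ^ (k + 2) = -(τ * z j ^ k) := by
    intro j
    have h := congrArg (Polynomial.eval (z j)) hroots
    rw [Polynomial.eval_prod, Finset.prod_eq_zero (Finset.mem_univ j) (by simp)] at h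
    simp at h
    linear_combination -h
  have hF : ∀ (d : ℕ) (F : Polynomial ℚ),
      Polynomial.aeval τ F = svalRank2Det (k + 2) z lam1 lam2 d → F.coeff d =
      (((-1) ^ d * ∑ p ∈ Finset.HasAntidiagonal.antidiagonal d,
        (binomInt (d + k - lam1 - 1 + k * p.1) ((k + 2) * (p.1 + 1) - (lam1 + 1 : ℕ) - 1) *
          binomInt (d + k - lam2 + k * p.2) ((k + 2) * (p.2 + 1) - lam2 - 1) -
        binomInt (d + k - lam1 + k * p.1) ((k + 2) * (p.1 + 1) - (lam1 + 1 : ℕ) - 1) *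
          binomInt (d + k - lam2 - 1 + k * p.2) ((k + 2) * (p.2 + 1) - lam2 - 1)) : ℤ) : ℚ) := by
    intro d F h
    rw [svalRank2Det_eq_aeval hk₁ hz hne hroot] at h
    rw [transcendental_iff_injective.1 hτ h, Polynomial.coeff_sub, residuePoly_mul_coeff hk₁,
      residuePoly_mul_coeff hk₁, Finset.sum_sub_distrib]
    push_cast
    ring
  refine ⟨fun F h => ?_, fun F h => ?_, fun F h => ?_, fun d hd F h => ?_⟩
  · have h₀ : F.coeff 0 = ((binomInt (k - lam1 - 1) (k - lam1) * binomInt (k - lam2) (k + 1 - lam2) -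
        binomInt (k - lam1) (k - lam1) * binomInt (k - lam2 - 1) (k + 1 - lam2) : ℤ) : ℚ) := by
      rw [hF 0 F h, Finset.Nat.sum_antidiagonal_eq_sum_range_succ_mk]
      simp only [Finset.sum_range_succ, Finset.sum_range_zero]
      push_cast
      ring_nf
    rw [h₀, binomInt_sub_one (M := k - lam1 - 1) (by ring),
      binomInt_sub_one (M := k - lam2) (by ring), binomInt_self (M := k - lam1) (by ring),
      binomInt_sub_two (M := k - lam2 - 1) (by ring)]
    split_ifs <;> first | omega | simp
  · have h₀ : F.coeff 1 = ((-(binomInt (k - lam1) (k - lam1) *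
          binomInt (2 * k + 1 - lam2) (2 * k + 3 - lam2) -
        binomInt (k - lam1 + 1) (k - lam1) * binomInt (2 * k - lam2) (2 * k + 3 - lam2) +
        (binomInt (2 * k - lam1) (2 * k + 2 - lam1) * binomInt (k + 1 - lam2) (k + 1 - lam2) -
        binomInt (2 * k - lam1 + 1) (2 * k + 2 - lam1) *
          binomInt (k - lam2) (k + 1 - lam2))) : ℤ) : ℚ) := by
      rw [hF 1 F h, Finset.Nat.sum_antidiagonal_eq_sum_range_succ_mk]
      simp only [Finset.sum_range_succ, Finset.sum_range_zero]
      push_cast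
      ring_nf
    have h₁ : binomInt (k - lam1) (k - lam1) *
          binomInt (2 * k + 1 - lam2) (2 * k + 3 - lam2) -
        binomInt (k - lam1 + 1) (k - lam1) *
          binomInt (2 * k - lam2) (2 * k + 3 - lam2) = 0 := by
      rcases le_or_gt lam1 k with hl | hl
      · rw [binomInt_eq_zero_of_lt (M := 2 * k + 1 - lam2) (by omega) (by omega),
          binomInt_eq_zero_of_lt (M := 2 * k - lam2) (by omega) (by omega)]
        ring
      · rw [binomInt_of_neg (M := k - lam1) (by omega),
          binomInt_of_neg (M := k - lam1 + 1) (by omega)]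
        ring
    rw [h₀, h₁, binomInt_sub_two (M := 2 * k - lam1) (by ring),
      binomInt_self (M := k + 1 - lam2) (by ring),
      binomInt_sub_one (M := 2 * k - lam1 + 1) (by ring),
      binomInt_sub_one (M := k - lam2) (by ring)]
    split_ifs <;> first | omega | simp
  · have h₀ : F.coeff 2 = ((binomInt (k + 1 - lam1) (k - lam1) *
          binomInt (3 * k + 2 - lam2) (3 * k + 5 - lam2) -
        binomInt (k + 2 - lam1) (k - lam1) * binomInt (3 * k + 1 - lam2) (3 * k + 5 - lam2) +
        (binomInt (2 * k + 1 - lam1) (2 * k + 2 - lam1) *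
          binomInt (2 * k + 2 - lam2) (2 * k + 3 - lam2) -
        binomInt (2 * k + 2 - lam1) (2 * k + 2 - lam1) *
          binomInt (2 * k + 1 - lam2) (2 * k + 3 - lam2)) +
        (binomInt (3 * k + 1 - lam1) (3 * k + 4 - lam1) * binomInt (k + 2 - lam2) (k + 1 - lam2) -
        binomInt (3 * k + 2 - lam1) (3 * k + 4 - lam1) *
          binomInt (k + 1 - lam2) (k + 1 - lam2)) : ℤ) : ℚ) := by
      rw [hF 2 F h, Finset.Nat.sum_antidiagonal_eq_sum_range_succ_mk]
      simp only [Finset.sum_range_succ, Finset.sum_range_zero]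
      push_cast
      ring_nf
    rw [h₀, binomInt_eq_zero_of_lt (M := 3 * k + 2 - lam2) (by omega) (by omega),
      binomInt_eq_zero_of_lt (M := 3 * k + 1 - lam2) (by omega) (by omega),
      binomInt_eq_zero_of_lt (M := 3 * k + 1 - lam1) (by omega) (by omega),
      binomInt_eq_zero_of_lt (M := 3 * k + 2 - lam1) (by omega) (by omega),
      binomInt_sub_one (M := 2 * k + 1 - lam1) (by ring),
      binomInt_sub_one (M := 2 * k + 2 - lam2) (by ring),
      binomInt_self (M := 2 * k + 2 - lam1) (by ring),
      binomInt_sub_two (M := 2 * k + 1 - lam2) (by ring)]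
    split_ifs <;> first | omega | simp
  · rw [hF d F h, Finset.sum_eq_zero, mul_zero, Int.cast_zero]
    rintro ⟨i, j⟩ hij
    rw [Finset.HasAntidiagonal.mem_antidiagonal] at hij
    dsimp only at hij ⊢
    rcases le_or_gt d (2 * j) with hj | hj
    · have : (k : ℤ) * 2 ≤ k * j := by gcongr; norm_cast; omega
      rw [binomInt_eq_zero_of_lt (M := d + k - lam2 + k * j) (by omega) (by ring_nf; omega),
        binomInt_eq_zero_of_lt (M := d + k - lam2 - 1 + k * j) (by omega) (by ring_nf; omega)]
      simp
    · have : (k : ℤ) * 2 ≤ k * i := by gcongr; norm_cast; omega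
      rw [binomInt_eq_zero_of_lt (M := d + k - lam1 - 1 + k * i) (by omega)
          (by push_cast; ring_nf; omega),
        binomInt_eq_zero_of_lt (M := d + k - lam1 + k * i) (by omega)
          (by push_cast; ring_nf; omega)]
      simp
end

section
/- Assume the rank-2 roots setup. Let ν = (ν_1 ≥ ν_2 ≥ 0) and α = (α_1 ≥ α_2 ≥ 0) be partitions with ν_1 ≤ 2k and α_1 ≤ k, and set α* = (k − α_2, k − α_1). For an integer d ≥ 0, define Φ_d = Σ_{1≤i<j≤N} G_ν(1 − z_i^{-1}, 1 − z_j^{-1}) · G_{α*}(1 − z_i^{-1}, 1 − z_j^{-1}) · (z_i z_j)^{N−3+d} / ∏_{l ∈ {1,…,N}, l ≠ i, l ≠ j} ( (z_i − z_l)(z_j − z_l) ), and let c_d denote the coefficient of T^d in any polynomial F ∈ ℚ[T] with F(τ) = Φ_d. Then: c_0 = 1 if ν = α and c_0 = 0 otherwise; c_1 = 1 if either ν + α* = (2k+1, k+1) or (ν_1 = α_1 + k + 1 and ν_2 ≤ α_2), c_1 = −1 if ν_1 = α_1 + k + 2 and ν_2 ≤ α_2, and c_1 = 0 otherwise; c_2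 = 1 if ν = (α_1 + N, α_2 + N) and c_2 = 0 otherwise; and c_d = 0 for all d ≥ 3. -/
/-- The two-variable stable Grothendieck polynomial `G_{(a_1,a_2)}` evaluated at field
elements `x, y`:
`G_a(x,y) = (x^{a_1+1} y^{a_2} (1-y) - y^{a_1+1} x^{a_2} (1-x)) / (x - y)`. -/
noncomputable def grothVal2 {K : Type*} [Field K] (a1 a2 : ℕ) (x y : K) : K :=
  (x ^ (a1 + 1) * y ^ a2 * (1 - y) - y ^ (a1 + 1) * x ^ a2 * (1 - x)) / (x - y)

/-- The localization expression
`Φ_d = Σ_{i<j} G_ν(1-z_i⁻¹,1-z_j⁻¹)·G_{α*}(1-z_i⁻¹,1-z_j⁻¹)·(z_i z_j)^{N-3+d}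
        / ∏_{l≠i,j} ((z_i-z_l)(z_j-z_l))`. -/
noncomputable def PhiRank2 {K : Type*} [Field K] (N : ℕ) (z : Fin N → K)
    (nu1 nu2 as1 as2 d : ℕ) : K :=
  ∑ p ∈ Finset.univ.filter (fun p : Fin N × Fin N => p.1 < p.2),
    grothVal2 nu1 nu2 (1 - (z p.1)⁻¹) (1 - (z p.2)⁻¹) *
      grothVal2 as1 as2 (1 - (z p.1)⁻¹) (1 - (z p.2)⁻¹) *
      (z p.1 * z p.2) ^ ((N : ℤ) - 3 + (d : ℤ)) /
      ∏ l ∈ Finset.univ.filter (fun l : Fin N => l ≠ p.1 ∧ l ≠ p.2),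
        ((z p.1 - z l) * (z p.2 - z l))

/-- The weighted power sum `Σ_i (1 - z_i⁻¹)^m z_i^{N-1+s} / ∏_{l ≠ i} (z_i - z_l)`. -/
noncomputable def rootSum {K : Type*} [Field K] {N : ℕ} (z : Fin N → K) (s : ℤ) (m : ℕ) : K :=
  ∑ i, Lagrange.nodalWeight Finset.univ z i * ((1 - (z i)⁻¹) ^ m * z i ^ ((N : ℤ) - 1 + s))

section RootSum

variable {K : Type*} [Field K] {N : ℕ} {z : Fin N → K}

theorem rootSum_eq_sub (hz0 : ∀ i, z i ≠ 0) (s : ℤ) (m : ℕ) :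
    rootSum z s m = rootSum z (s + 1) m - rootSum z (s + 1) (m + 1) := by
  simp only [rootSum, ← Finset.sum_sub_distrib]
  refine Finset.sum_congr rfl fun i _ => ?_
  rw [← add_assoc, zpow_add_one₀ (hz0 i)]
  rw [pow_succ]
  generalize (1 - (z i)⁻¹) ^ m = x
  linear_combination (-Lagrange.nodalWeight Finset.univ z i * x * z i ^ ((N : ℤ) - 1 + s)) *
    mul_inv_cancel₀ (hz0 i)

theorem rootSum_add_card {τ : K} (hz0 : ∀ i, z i ≠ 0)
    (hroot : ∀ i, (z i - 1) ^ N = -τ * z i ^ ((N : ℤ) - 2)) (s : ℤ) (m : ℕ) :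
    rootSum z s (m + N) = -τ * rootSum z (s - 2) m := by
  simp only [rootSum, Finset.mul_sum]
  refine Finset.sum_congr rfl fun i _ => ?_
  have h := hz0 i
  have h1 : (1 - (z i)⁻¹) ^ N = -τ * (z i ^ 2)⁻¹ := by
    have : 1 - (z i)⁻¹ = (z i - 1) / z i := by field_simp
    rw [this, div_pow, hroot, zpow_sub₀ h, zpow_natCast]
    norm_cast
    field_simp
  rw [pow_add, h1, show (N : ℤ) - 1 + (s - 2) = (N : ℤ) - 1 + s - 2 by ring, zpow_sub₀ h]
  norm_cast
  field_simp

open Polynomial in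
theorem rootSum_zero (hz : Function.Injective z) (hz0 : ∀ i, z i ≠ 0) {m : ℕ} (hm : m < N) :
    rootSum z 0 m = 1 := by
  have hmon : (X ^ (N - 1 - m) * (X - C (1 : K)) ^ m).Monic :=
    (monic_X_pow _).mul ((monic_X_sub_C _).pow _)
  have hdeg : (X ^ (N - 1 - m) * (X - C (1 : K)) ^ m).natDegree = N - 1 := by
    rw [(monic_X_pow _).natDegree_mul ((monic_X_sub_C _).pow _), natDegree_X_pow,
      (monic_X_sub_C _).natDegree_pow, natDegree_X_sub_C]
    omega
  have key := Lagrange.leadingCoeff_eq_sum (s := Finset.univ) (v := z) hz.injOn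
    (P := X ^ (N - 1 - m) * (X - C (1 : K)) ^ m) (by
      rw [degree_eq_natDegree hmon.ne_zero, hdeg, Finset.card_univ, Fintype.card_fin]
      norm_cast
      omega)
  rw [hmon.leadingCoeff] at key
  rw [key, rootSum]
  refine Finset.sum_congr rfl fun i _ => ?_
  have h := hz0 i
  have h1 : 1 - (z i)⁻¹ = (z i - 1) / z i := by field_simp
  have h2 : z i ^ ((N : ℤ) - 1 + 0) = z i ^ (N - 1 - m) * z i ^ m := by
    rw [← pow_add, ← zpow_natCast]
    congr 1
    omega
  rw [h2, h1, Lagrange.nodalWeight, Finset.prod_inv_distrib, div_pow]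
  simp only [eval_mul, eval_pow, eval_X, eval_sub, eval_C]
  field_simp

theorem rootSum_mem_range [CharZero K] {τ : K} (hN : 3 ≤ N) (hz : Function.Injective z)
    (hz0 : ∀ i, z i ≠ 0) (hroot : ∀ i, (z i - 1) ^ N = -τ * z i ^ ((N : ℤ) - 2))
    (s : ℤ) (m : ℕ) :
    rootSum z s m ∈ (Polynomial.aeval (R := ℚ) τ).range := by
  have hτ : -τ ∈ (Polynomial.aeval (R := ℚ) τ).range := ⟨-Polynomial.X, by simp⟩
  have hsub := rootSum_eq_sub hz0
  have hadd := rootSum_add_card hz0 hroot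
  have base : ∀ m, rootSum z 0 m ∈ (Polynomial.aeval (R := ℚ) τ).range := by
    intro m
    induction m using Nat.strong_induction_on with
    | _ m ih =>
      rcases lt_or_ge m N with hm | hm
      · rw [rootSum_zero hz hz0 hm]
        exact one_mem _
      · obtain ⟨n, rfl⟩ := Nat.exists_eq_add_of_le' hm
        have h1 := hsub (-1) n
        have h2 := hsub (-1) (n + 1)
        have h3 := hsub (-2) n
        norm_num at h1 h2 h3
        rw [hadd, show (0 : ℤ) - 2 = -2 by norm_num, h3, h1, h2]
        exact mul_mem hτ (sub_mem (sub_mem (ih _ (by omega)) (ih _ (by omega)))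
          (sub_mem (ih _ (by omega)) (ih _ (by omega))))
  have neg : ∀ (n m : ℕ), rootSum z (-(n : ℤ)) m ∈ (Polynomial.aeval (R := ℚ) τ).range := by
    intro n
    induction n with
    | zero => simpa using base
    | succ n ih =>
      intro m
      rw [hsub, show -((n + 1 : ℕ) : ℤ) + 1 = -(n : ℤ) by push_cast; ring]
      exact sub_mem (ih _) (ih _)
  have pos : ∀ (n m : ℕ), rootSum z (n : ℤ) m ∈ (Polynomial.aeval (R := ℚ) τ).range := by
    intro n
    induction n using Nat.strong_induction_on with
    | _ n ih =>
      intro m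
      rcases Nat.eq_zero_or_pos n with rfl | hn
      · simpa using base m
      have big : ∀ m, N ≤ m → rootSum z (n : ℤ) m ∈ (Polynomial.aeval (R := ℚ) τ).range := by
        intro m hm
        obtain ⟨l, rfl⟩ := Nat.exists_eq_add_of_le' hm
        rw [hadd]
        refine mul_mem hτ ?_
        rcases lt_or_ge n 2 with h2 | h2
        · have := neg 1 l
          rwa [show (n : ℤ) - 2 = -((1 : ℕ) : ℤ) by omega]
        · have := ih (n - 2) (by omega) l
          rwa [show (n : ℤ) - 2 = ((n - 2 : ℕ) : ℤ) by omega]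
      rcases le_total N m with hm | hm
      · exact big m hm
      · induction hm using Nat.decreasingInduction with
        | self => exact big N le_rfl
        | of_succ l hl ihl =>
          have h1 := hsub ((n - 1 : ℕ) : ℤ) l
          rw [show ((n - 1 : ℕ) : ℤ) + 1 = (n : ℤ) by omega] at h1
          rw [← sub_add_cancel (rootSum z (n : ℤ) l) (rootSum z (n : ℤ) (l + 1)), ← h1]
          exact add_mem (ih (n - 1) (by omega) l) ihl
  obtain ⟨n, rfl | rfl⟩ := s.eq_nat_or_neg
  · exact pos n m
  · exact neg n m

end RootSum

/-- For a summand `w` vanishing on the diagonal, the symmetrised sum over `i < j` is the sum over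
all pairs. -/
theorem sum_lt_add_swap {K : Type*} [AddCommMonoid K] {N : ℕ} (w : Fin N → Fin N → K)
    (hw : ∀ i, w i i = 0) :
    ∑ p ∈ Finset.univ.filter (fun p : Fin N × Fin N => p.1 < p.2), (w p.1 p.2 + w p.2 p.1) =
      ∑ i, ∑ j, w i j := by
  simp only [Finset.sum_filter, Fintype.sum_prod_type]
  have h : ∀ i j, (if i < j then w i j + w j i else 0) =
      (if i < j then w i j else 0) + (if i < j then w j i else 0) := by
    intro i j
    split_ifs <;> simp
  simp only [h, Finset.sum_add_distrib]
  rw [Finset.sum_comm (f := fun i j => if i < j then w j i else 0)]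
  simp only [← Finset.sum_add_distrib]
  refine Finset.sum_congr rfl fun i _ => Finset.sum_congr rfl fun j _ => ?_
  rcases lt_trichotomy i j with h | rfl | h
  · simp [h, h.not_gt]
  · simp [hw]
  · simp [h, h.not_gt]

theorem inv_prod_ne_eq_nodalWeight {K : Type*} [Field K] {N : ℕ} {z : Fin N → K}
    (hz : Function.Injective z) {i j : Fin N} (hij : i ≠ j) :
    (∏ l ∈ Finset.univ.filter (fun l : Fin N => l ≠ i ∧ l ≠ j),
        ((z i - z l) * (z j - z l)))⁻¹ =
      -((z i - z j) ^ 2 * (Lagrange.nodalWeight Finset.univ z i *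
        Lagrange.nodalWeight Finset.univ z j)) := by
  have hi : Lagrange.nodalWeight Finset.univ z i = (z i - z j)⁻¹ *
      ∏ l ∈ Finset.univ.filter (fun l : Fin N => l ≠ i ∧ l ≠ j), (z i - z l)⁻¹ := by
    rw [Lagrange.nodalWeight, ← Finset.mul_prod_erase _ _ (a := j) (by simp [hij.symm])]
    congr 2
    ext l
    simp [and_comm]
  have hj : Lagrange.nodalWeight Finset.univ z j = (z j - z i)⁻¹ *
      ∏ l ∈ Finset.univ.filter (fun l : Fin N => l ≠ i ∧ l ≠ j), (z j - z l)⁻¹ := by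
    rw [Lagrange.nodalWeight, ← Finset.mul_prod_erase _ _ (a := i) (by simp [hij])]
    congr 2
    ext l
    simp
  have h : z i - z j ≠ 0 := sub_ne_zero.2 (hz.ne hij)
  rw [hi, hj, Finset.prod_mul_distrib, mul_inv, Finset.prod_inv_distrib, Finset.prod_inv_distrib,
    ← neg_sub (z i) (z j)]
  generalize (∏ l ∈ _, (z i - z l))⁻¹ = a
  generalize (∏ l ∈ _, (z j - z l))⁻¹ = b
  field_simp

theorem grothVal2_one_sub_inv {K : Type*} [Field K] (a1 a2 : ℕ) {s t : K} (hs : s ≠ 0)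
    (ht : t ≠ 0) (hst : s ≠ t) :
    grothVal2 a1 a2 (1 - s⁻¹) (1 - t⁻¹) =
      ((1 - s⁻¹) ^ (a1 + 1) * (1 - t⁻¹) ^ a2 * s - (1 - t⁻¹) ^ (a1 + 1) * (1 - s⁻¹) ^ a2 * t) /
        (s - t) := by
  have h : s - t ≠ 0 := sub_ne_zero.2 hst
  have h1 : (1 - s⁻¹) - (1 - t⁻¹) = (s - t) / (s * t) := by
    field_simp
    ring
  rw [grothVal2, h1, sub_sub_cancel, sub_sub_cancel]
  generalize 1 - s⁻¹ = x
  generalize 1 - t⁻¹ = y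
  field_simp

theorem PhiRank2_eq_rootSum {K : Type*} [Field K] {N : ℕ} {z : Fin N → K}
    (hz : Function.Injective z) (hz0 : ∀ i, z i ≠ 0) (nu1 nu2 as1 as2 d : ℕ) :
    PhiRank2 N z nu1 nu2 as1 as2 d =
      rootSum z ((d : ℤ) - 1) (nu1 + as2 + 1) * rootSum z ((d : ℤ) - 1) (nu2 + as1 + 1) -
        rootSum z d (nu1 + as1 + 2) * rootSum z ((d : ℤ) - 2) (nu2 + as2) := by
  set c : Fin N → K := Lagrange.nodalWeight Finset.univ z with hc
  set u : Fin N → K := fun i => z i ^ ((N : ℤ) - 3 + d) with hu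
  have e0 : ∀ i, z i ^ ((N : ℤ) - 1 + ((d : ℤ) - 2)) = u i := fun i => by
    rw [hu]; congr 1; ring
  have e1 : ∀ i, z i ^ ((N : ℤ) - 1 + ((d : ℤ) - 1)) = u i * z i := fun i => by
    rw [hu, ← zpow_add_one₀ (hz0 i)]; congr 1; ring
  have e2 : ∀ i, z i ^ ((N : ℤ) - 1 + (d : ℤ)) = u i * z i * z i := fun i => by
    rw [hu, ← zpow_add_one₀ (hz0 i), ← zpow_add_one₀ (hz0 i)]; congr 1; ring
  let x : Fin N → K := fun i => 1 - (z i)⁻¹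
  let w : Fin N → Fin N → K := fun i j =>
    c i * (x i ^ (nu1 + as2 + 1) * (u i * z i)) * (c j * (x j ^ (nu2 + as1 + 1) * (u j * z j))) -
    c i * (x i ^ (nu1 + as1 + 2) * (u i * z i * z i)) * (c j * (x j ^ (nu2 + as2) * u j))
  have hw : ∀ i, w i i = 0 := fun i => by simp only [w]; ring
  have hR : rootSum z ((d : ℤ) - 1) (nu1 + as2 + 1) * rootSum z ((d : ℤ) - 1) (nu2 + as1 + 1) -
        rootSum z d (nu1 + as1 + 2) * rootSum z ((d : ℤ) - 2) (nu2 + as2) = ∑ i, ∑ j, w i j := by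
    simp only [rootSum, Finset.sum_mul_sum, ← Finset.sum_sub_distrib, e0, e1, e2, w, x, hc]
  rw [hR, ← sum_lt_add_swap w hw, PhiRank2]
  refine Finset.sum_congr rfl fun p hp => ?_
  have hij : p.1 ≠ p.2 := (Finset.mem_filter.1 hp).2.ne
  have hne : z p.1 - z p.2 ≠ 0 := sub_ne_zero.2 (hz.ne hij)
  rw [div_eq_mul_inv, inv_prod_ne_eq_nodalWeight hz hij, mul_zpow,
    grothVal2_one_sub_inv _ _ (hz0 _) (hz0 _) (hz.ne hij),
    grothVal2_one_sub_inv _ _ (hz0 _) (hz0 _) (hz.ne hij)]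
  change (_ / _) * (_ / _) * (u p.1 * u p.2) * _ = _
  simp only [w, x, ← hc]
  generalize 1 - (z p.1)⁻¹ = x1
  generalize 1 - (z p.2)⁻¹ = x2
  field_simp
  ring

/-- The relations between the power sums `rootSum`, lifted to polynomials in `τ`. -/
structure IsRootSumSystem (N : ℕ) (q : ℤ → ℕ → Polynomial ℚ) : Prop where
  eq_sub : ∀ s m, q s m = q (s + 1) m - q (s + 1) (m + 1)
  add_card : ∀ s m, q s (m + N) = -(Polynomial.X * q (s - 2) m)
  zero_of_lt : ∀ m, m < N → q 0 m = 1

theorem exists_isRootSumSystem {K : Type*} [Field K] [CharZero K] {N : ℕ} {z : Fin N → K} {τ : K}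
    (hτ : Transcendental ℚ τ) (hN : 3 ≤ N) (hz : Function.Injective z)
    (hz0 : ∀ i, z i ≠ 0) (hroot : ∀ i, (z i - 1) ^ N = -τ * z i ^ ((N : ℤ) - 2)) :
    ∃ q, IsRootSumSystem N q ∧ ∀ s m, Polynomial.aeval τ (q s m) = rootSum z s m := by
  choose q hq using fun s m => rootSum_mem_range hN hz hz0 hroot s m
  have hq' : ∀ s m, Polynomial.aeval τ (q s m) = rootSum z s m := hq
  have inj := transcendental_iff_injective.1 hτ
  refine ⟨q, ⟨fun s m => inj ?_, fun s m => inj ?_, fun m hm => inj ?_⟩, hq'⟩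
  · rw [map_sub, hq', hq', hq', rootSum_eq_sub hz0]
  · rw [map_neg, map_mul, Polynomial.aeval_X, hq', hq', rootSum_add_card hz0 hroot, neg_mul]
  · rw [map_one, hq', rootSum_zero hz hz0 hm]

namespace IsRootSumSystem

variable {N : ℕ} {q : ℤ → ℕ → Polynomial ℚ}

theorem coeff_eq_sub (h : IsRootSumSystem N q) (j : ℕ) (s : ℤ) (m : ℕ) :
    (q s m).coeff j = (q (s + 1) m).coeff j - (q (s + 1) (m + 1)).coeff j := by
  rw [h.eq_sub, Polynomial.coeff_sub]

theorem coeff_zero_of_le (h : IsRootSumSystem N q) (s : ℤ) {m : ℕ} (hm : N ≤ m) :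
    (q s m).coeff 0 = 0 := by
  obtain ⟨l, rfl⟩ := Nat.exists_eq_add_of_le' hm
  simp [h.add_card]

theorem coeff_succ_of_le (h : IsRootSumSystem N q) (j : ℕ) (s : ℤ) {m : ℕ} (hm : N ≤ m) :
    (q s m).coeff (j + 1) = -(q (s - 2) (m - N)).coeff j := by
  obtain ⟨l, rfl⟩ := Nat.exists_eq_add_of_le' hm
  simp [h.add_card]

theorem coeff_zero_zero (h : IsRootSumSystem N q) (m : ℕ) :
    (q 0 m).coeff 0 = if m < N then 1 else 0 := by
  split_ifs with hm
  · simp [h.zero_of_lt m hm]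
  · exact h.coeff_zero_of_le 0 (not_lt.1 hm)

theorem coeff_zero_neg_one (h : IsRootSumSystem N q) (m : ℕ) :
    (q (-1) m).coeff 0 = if m + 1 = N then 1 else 0 := by
  rw [h.coeff_eq_sub, neg_add_cancel, h.coeff_zero_zero, h.coeff_zero_zero]
  grind

theorem coeff_zero_neg_two (h : IsRootSumSystem N q) (m : ℕ) :
    (q (-2) m).coeff 0 = (if m + 1 = N then 1 else 0) - if m + 2 = N then 1 else 0 := by
  rw [h.coeff_eq_sub, show (-2 : ℤ) + 1 = -1 by norm_num, h.coeff_zero_neg_one,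
    h.coeff_zero_neg_one]

theorem coeff_eq_zero (h : IsRootSumSystem N q) (hN : 3 ≤ N) (j : ℕ) :
    ∀ (s : ℤ) (m : ℕ), s < 2 * j → (m : ℤ) < N + s + (N - 2) * j → (q s m).coeff j = 0 := by
  induction j with
  | zero =>
    intro s
    induction s using Int.negInduction with
    | nat n => intro m h1; simp at h1; omega
    | neg _ n =>
      induction n with
      | zero => intro m h1; simp at h1
      | succ n ih =>
        intro m h1 h2
        rw [h.coeff_eq_sub, show -((n + 1 : ℕ) : ℤ) + 1 = -(n : ℤ) by push_cast; ring]
        rcases Nat.eq_zero_or_pos n with rfl | hn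
        · simp only [Nat.cast_zero, neg_zero, h.coeff_zero_zero]
          push_cast at h2
          rw [if_pos (by omega), if_pos (by omega), sub_self]
        · push_cast at h2 ih
          rw [ih _ (by omega) (by omega), ih _ (by omega) (by push_cast; omega), sub_self]
  | succ j ihj =>
    have hj : (0 : ℤ) ≤ (N - 2) * j := mul_nonneg (by omega) (by omega)
    have big : ∀ (s : ℤ) (m : ℕ), N ≤ m → s < 2 * (j + 1 : ℕ) →
        (m : ℤ) < N + s + (N - 2) * (j + 1 : ℕ) → (q s m).coeff (j + 1) = 0 := by
      intro s m hm h1 h2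
      push_cast at h1 h2
      rw [mul_add] at h2
      rw [h.coeff_succ_of_le _ _ hm, ihj _ _ (by omega) (by omega), neg_zero]
    have base : ∀ m : ℕ, (m : ℤ) < N + 0 + (N - 2) * (j + 1 : ℕ) →
        (q 0 m).coeff (j + 1) = 0 := by
      intro m h2
      rcases lt_or_ge m N with hm | hm
      · simp [h.zero_of_lt m hm, Polynomial.coeff_one]
      · exact big _ _ hm (by positivity) h2
    intro s
    induction s using Int.induction_on with
    | zero => exact fun m _ => base m
    | succ n ih =>
      intro m h1 h2
      rcases le_total N m with hm | hm
      · exact big _ _ hm h1 h2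
      · have h3 : (N : ℤ) < N + (n + 1) + (N - 2) * (j + 1 : ℕ) := by
          push_cast
          rw [mul_add]
          omega
        clear h2
        induction hm using Nat.decreasingInduction with
        | self => exact big _ _ le_rfl h1 h3
        | of_succ l hl ihl =>
          have h4 := h.coeff_eq_sub (j + 1) n l
          rw [ihl, sub_zero] at h4
          rw [← h4]
          exact ih l (by omega) (by omega)
    | pred n ih =>
      intro m h1 h2
      rw [h.coeff_eq_sub, sub_add_cancel,
        ih _ (by push_cast; omega) (by omega), ih _ (by push_cast; omega) (by push_cast at *; omega),
        sub_self]

theorem coeff_one_zero (h : IsRootSumSystem N q) (hN : 3 ≤ N) (m : ℕ) :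
    (q 0 m).coeff 1 = (if m + 2 = 2 * N then 1 else 0) - if m + 1 = 2 * N then 1 else 0 := by
  rcases lt_or_ge m N with hm | hm
  · rw [h.zero_of_lt m hm, if_neg (by omega), if_neg (by omega)]
    simp [Polynomial.coeff_one]
  · rw [h.coeff_succ_of_le 0 _ hm, zero_sub, h.coeff_zero_neg_two]
    grind

theorem coeff_one_one (h : IsRootSumSystem N q) (hN : 3 ≤ N) (m : ℕ) :
    (q 1 m).coeff 1 = if m + 1 = 2 * N then -1 else 0 := by
  rcases lt_or_ge m N with hm | hm
  · rw [h.coeff_eq_zero hN 1 1 m (by norm_num) (by push_cast; omega), if_neg (by omega)]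
  · rw [h.coeff_succ_of_le 0 _ hm, show (1 : ℤ) - 2 = -1 by norm_num, h.coeff_zero_neg_one]
    grind

theorem coeff_one_two_of_le (h : IsRootSumSystem N q) {m : ℕ} (hm : 2 * N ≤ m) :
    (q 2 m).coeff 1 = 0 := by
  rw [h.coeff_succ_of_le 0 _ (by omega), sub_self, h.coeff_zero_of_le _ (by omega), neg_zero]

end IsRootSumSystem

/-- Rank-2 roots setup (`k = N-2`,
`∏(X - z_i) = (X-1)^N + τ X^{N-2}`, `τ` transcendental over `ℚ`). For partitions
`ν = (ν_1 ≥ ν_2 ≥ 0)` with `ν_1 ≤ 2k` and `α = (α_1 ≥ α_2 ≥ 0)` with `α_1 ≤ k`, and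
`α* = (k-α_2, k-α_1)`, the coefficients `c_d` of `T^d` in any `F ∈ ℚ[T]` with
`F(τ) = Φ_d` satisfy the stated case formulas. -/
theorem stmt14 {K : Type*} [Field K] [CharZero K] (N : ℕ) (hN : 3 ≤ N)
    (k : ℕ) (hk : k = N - 2)
    (τ : K) (hτ : Transcendental ℚ τ)
    (z : Fin N → K) (hz : Function.Injective z)
    (hroots : ∏ i, (Polynomial.X - Polynomial.C (z i)) =
      (Polynomial.X - Polynomial.C (1 : K)) ^ N + Polynomial.C τ * Polynomial.X ^ (N - 2))
    (nu1 nu2 : ℕ) (hnu : nu2 ≤ nu1) (hnu1 : nu1 ≤ 2 * k)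
    (al1 al2 : ℕ) (hal : al2 ≤ al1) (hal1 : al1 ≤ k) :
    (∀ F : Polynomial ℚ,
      Polynomial.aeval τ F = PhiRank2 N z nu1 nu2 (k - al2) (k - al1) 0 →
        F.coeff 0 = if nu1 = al1 ∧ nu2 = al2 then 1 else 0) ∧
    (∀ F : Polynomial ℚ,
      Polynomial.aeval τ F = PhiRank2 N z nu1 nu2 (k - al2) (k - al1) 1 →
        F.coeff 1 =
          if (nu1 + (k - al2) = 2 * k + 1 ∧ nu2 + (k - al1) = k + 1) ∨
              (nu1 = al1 + k + 1 ∧ nu2 ≤ al2) then 1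
          else if nu1 = al1 + k + 2 ∧ nu2 ≤ al2 then -1
          else 0) ∧
    (∀ F : Polynomial ℚ,
      Polynomial.aeval τ F = PhiRank2 N z nu1 nu2 (k - al2) (k - al1) 2 →
        F.coeff 2 = if nu1 = al1 + N ∧ nu2 = al2 + N then 1 else 0) ∧
    (∀ d : ℕ, 3 ≤ d → ∀ F : Polynomial ℚ,
      Polynomial.aeval τ F = PhiRank2 N z nu1 nu2 (k - al2) (k - al1) d →
        F.coeff d = 0) := by
  have hroot0 : ∀ i, (z i - 1) ^ N + τ * z i ^ (N - 2) = 0 := by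
    intro i
    have := congrArg (Polynomial.eval (z i)) hroots
    rw [Polynomial.eval_prod, Finset.prod_eq_zero (Finset.mem_univ i) (by simp)] at this
    simpa using this.symm
  have hz0 : ∀ i, z i ≠ 0 := by
    intro i hi
    have := hroot0 i
    rw [hi, zero_pow (by omega : N - 2 ≠ 0)] at this
    simp at this
  have hroot : ∀ i, (z i - 1) ^ N = -τ * z i ^ ((N : ℤ) - 2) := by
    intro i
    rw [show (N : ℤ) - 2 = ((N - 2 : ℕ) : ℤ) by omega, zpow_natCast]
    linear_combination hroot0 i
  obtain ⟨q, h, hq⟩ := exists_isRootSumSystem hτ hN hz hz0 hroot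
  have hF : ∀ (d : ℕ) (F : Polynomial ℚ),
      Polynomial.aeval τ F = PhiRank2 N z nu1 nu2 (k - al2) (k - al1) d →
      F = q ((d : ℤ) - 1) (nu1 + (k - al1) + 1) * q ((d : ℤ) - 1) (nu2 + (k - al2) + 1) -
        q d (nu1 + (k - al2) + 2) * q ((d : ℤ) - 2) (nu2 + (k - al1)) := by
    intro d F hd
    apply transcendental_iff_injective.1 hτ
    rw [hd, PhiRank2_eq_rootSum hz hz0]
    simp only [map_sub, map_mul, hq]
  have vanish : ∀ (s : ℤ) (m j : ℕ), 2 ≤ j → s < 2 * j → (m : ℤ) < 3 * N - 4 + s →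
      (q s m).coeff j = 0 := by
    intro s m j h2 hs hm
    have hj : ((N : ℤ) - 2) * 2 ≤ (N - 2) * j :=
      mul_le_mul_of_nonneg_left (by omega) (by omega)
    exact h.coeff_eq_zero hN j s m hs (by omega)
  obtain ⟨A, hA⟩ : ∃ A, A = nu1 + (k - al1) + 1 := ⟨_, rfl⟩
  obtain ⟨B, hB⟩ : ∃ B, B = nu2 + (k - al2) + 1 := ⟨_, rfl⟩
  obtain ⟨C, hC⟩ : ∃ C, C = nu1 + (k - al2) + 2 := ⟨_, rfl⟩
  obtain ⟨D, hD⟩ : ∃ D, D = nu2 + (k - al1) := ⟨_, rfl⟩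
  rw [← hA, ← hB, ← hC, ← hD] at hF
  refine ⟨fun F hd => ?_, fun F hd => ?_, fun F hd => ?_, fun d hd3 F hd => ?_⟩
  · have e := hF 0 F hd
    norm_num at e
    rw [e, Polynomial.coeff_sub, Polynomial.mul_coeff_zero, Polynomial.mul_coeff_zero,
      h.coeff_zero_neg_one, h.coeff_zero_neg_one, h.coeff_zero_zero, h.coeff_zero_neg_two]
    have hCD : C < N → D + 2 < N := by omega
    grind
  · have e := hF 1 F hd
    norm_num at e
    have hCD : (q 1 C).coeff 0 * (q (-1) D).coeff 1 = 0 := by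
      rcases lt_or_ge C N with hCN | hCN
      · rw [h.coeff_eq_zero hN 1 (-1) D (by norm_num) (by push_cast; omega), mul_zero]
      · rw [h.coeff_zero_of_le _ hCN, zero_mul]
    have hAB : (q 0 A).coeff 0 * (q 0 B).coeff 1 = 0 := by
      rcases lt_or_ge A N with hAN | hAN
      · rw [h.coeff_one_zero hN, if_neg (by omega), if_neg (by omega), sub_self, mul_zero]
      · rw [h.coeff_zero_of_le _ hAN, zero_mul]
    rw [e, Polynomial.coeff_sub, Polynomial.mul_coeff_one, Polynomial.mul_coeff_one, hCD, hAB,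
      zero_add, zero_add, h.coeff_zero_zero, h.coeff_one_zero hN, h.coeff_one_one hN,
      h.coeff_zero_neg_one]
    have iA2 : A + 2 = 2 * N ↔ nu1 = al1 + k + 1 := by omega
    have iA1 : A + 1 = 2 * N ↔ nu1 = al1 + k + 2 := by omega
    have iB : B < N ↔ nu2 ≤ al2 := by omega
    have iC : C + 1 = 2 * N ↔ nu1 + (k - al2) = 2 * k + 1 := by omega
    have iD : D + 1 = N ↔ nu2 + (k - al1) = k + 1 := by omega
    simp only [iA1, iA2, iB, iC, iD]
    by_cases hB2 : nu2 ≤ al2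
    · have hD2 : nu2 + (k - al1) ≠ k + 1 := by omega
      by_cases h1 : nu1 = al1 + k + 1
      · have h2 : nu1 ≠ al1 + k + 2 := by omega
        simp [hB2, hD2, h1]
      · simp only [hB2, hD2, h1, and_true, and_false, or_false, if_true, if_false, mul_zero,
          sub_zero, mul_one, zero_sub]
        split_ifs <;> simp
    · simp only [hB2, and_false, or_false, if_false, mul_zero, zero_sub]
      by_cases h1 : nu1 + (k - al2) = 2 * k + 1 <;>
        by_cases h2 : nu2 + (k - al1) = k + 1 <;> simp [h1, h2]
  · have e := hF 2 F hd
    norm_num at e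
    have hCD : (q 2 C).coeff 1 * (q 0 D).coeff 1 = 0 := by
      rcases lt_or_ge C (2 * N) with hCN | hCN
      · rw [h.coeff_one_zero hN, if_neg (by omega), if_neg (by omega), sub_self, mul_zero]
      · rw [h.coeff_one_two_of_le hCN, zero_mul]
    rw [e, Polynomial.coeff_sub, Polynomial.coeff_mul, Polynomial.coeff_mul]
    simp only [Finset.Nat.sum_antidiagonal_eq_sum_range_succ_mk, Finset.sum_range_succ,
      Finset.sum_range_zero, Nat.succ_eq_add_one, Nat.sub_zero, Nat.sub_self, zero_add]
    rw [vanish 1 A 2 le_rfl (by norm_num) (by omega), vanish 1 B 2 le_rfl (by norm_num) (by omega),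
      vanish 2 C 2 le_rfl (by norm_num) (by omega), vanish 0 D 2 le_rfl (by norm_num) (by omega),
      hCD, h.coeff_one_one hN, h.coeff_one_one hN]
    have iA : A + 1 = 2 * N ↔ nu1 = al1 + N := by omega
    have iB : B + 1 = 2 * N ↔ nu2 = al2 + N := by omega
    simp only [iA, iB]
    by_cases h1 : nu1 = al1 + N <;> by_cases h2 : nu2 = al2 + N <;> simp [h1, h2]
  · have hAB : (q ((d : ℤ) - 1) A * q ((d : ℤ) - 1) B).coeff d = 0 := by
      rw [Polynomial.coeff_mul]
      refine Finset.sum_eq_zero fun p hp => ?_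
      rw [Finset.HasAntidiagonal.mem_antidiagonal] at hp
      rcases lt_or_ge (d : ℤ) (2 * p.1 + 1) with hlt | hge
      · rw [vanish _ A _ (by omega) (by omega) (by omega), zero_mul]
      · rw [vanish _ B _ (by omega) (by omega) (by omega), mul_zero]
    have hCD : (q d C * q ((d : ℤ) - 2) D).coeff d = 0 := by
      rw [Polynomial.coeff_mul]
      refine Finset.sum_eq_zero fun p hp => ?_
      rw [Finset.HasAntidiagonal.mem_antidiagonal] at hp
      rcases lt_or_ge (d : ℤ) (2 * p.1) with hlt | hge
      · rw [vanish _ C _ (by omega) (by omega) (by omega), zero_mul]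
      · rw [vanish _ D _ (by omega) (by omega) (by omega), mul_zero]
    rw [hF d F hd, Polynomial.coeff_sub, hAB, hCD, sub_self]
end
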